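/- arXiv:2410.04750 — 4 statements merged into one kernel-verified Lean document; each statement's English description precedes it below -/
import Mathlib

section
/- Let (M, r₊, Λ, α, q₀) be sub-extremal parameters with -9/4 < α < 0 and let φ = e^{iωt}ψ(r) be a mode solution of the charged Klein–Gordon equation on Reissner–Nordström–AdS satisfying the Dirichlet boundary condition at infinity and the regularity condition ψ(r) = e^{iω r*(r)} ρ(r) near r = r₊ with ρ smooth on [r₊, ∞). If ω ∈ ℝ, then ω = 0, i.e. the only real-mode regular solutions are static. -/
open Set Filter Topology Real

open ComplexConjugate in
/-- Abstract vanishing of the flux at infinity using a positive supersolution `w`. -/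
lemma flux_zero (a W0 : ℝ) (p w dw z v : ℝ → ℝ) (ψ dψ : ℝ → ℂ)
    (h1 : ∀ r > a, HasDerivAt ψ (dψ r) r)
    (h2 : ∀ r > a, HasDerivAt (fun r => (p r : ℂ) * dψ r) ((v r : ℂ) * ψ r) r)
    (h3 : ∀ r > a, HasDerivAt w (dw r) r)
    (h4 : ∀ r > a, HasDerivAt (fun r => p r * dw r) (z r) r)
    (h5 : ∀ r > a, z r ≤ v r * w r)
    (hp : ∀ r > a, 0 < p r) (hw : ∀ r > a, 0 < w r)
    (hlim : Tendsto (fun r => ψ r / (w r : ℂ)) atTop (𝓝 0))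
    (hW : ∀ r > a, (conj (ψ r) * ((p r : ℂ) * dψ r)).im = W0) : W0 = 0 := by
  set χ : ℝ → ℂ := fun r => ψ r / (w r : ℂ) with hχ
  set N : ℝ → ℂ := fun r => (w r : ℂ) * ((p r : ℂ) * dψ r) - ((p r * dw r : ℝ) : ℂ) * ψ r with hN
  set T : ℝ → ℝ := fun r => v r * w r - z r with hT
  have hT0 : ∀ r > a, 0 ≤ T r := fun r hr => sub_nonneg.2 (h5 r hr)
  have hNd : ∀ r > a, HasDerivAt N ((T r : ℂ) * ψ r) r := by
    intro r hr
    have := ((h3 r hr).ofReal_comp.mul (h2 r hr)).sub ((h4 r hr).ofReal_comp.mul (h1 r hr))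
    refine HasDerivAt.congr_deriv (f := N) this ?_
    simp only [hT]; push_cast; ring
  have hχd : ∀ r > a, HasDerivAt χ (N r / ((p r * w r ^ 2 : ℝ) : ℂ)) r := by
    intro r hr
    have hw0 : (w r : ℂ) ≠ 0 := by exact_mod_cast (hw r hr).ne'
    have hp0 : (p r : ℂ) ≠ 0 := by exact_mod_cast (hp r hr).ne'
    have := (h1 r hr).div ((h3 r hr).ofReal_comp) hw0
    refine HasDerivAt.congr_deriv (f := χ) this ?_
    simp only [hN]; push_cast; field_simp
  have hψχ : ∀ r > a, ψ r = (w r : ℂ) * χ r := by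
    intro r hr
    have hw0 : (w r : ℂ) ≠ 0 := by exact_mod_cast (hw r hr).ne'
    simp only [hχ]; field_simp
  -- real inner products
  have hdotd : ∀ {f g : ℝ → ℂ} {f' g' : ℂ} {r : ℝ}, HasDerivAt f f' r → HasDerivAt g g' r →
      HasDerivAt (fun r => (conj (f r) * g r).re) ((conj f' * g r + conj (f r) * g').re) r := by
    intro f g f' g' r hf hg
    have h := (hf.star).mul hg
    exact (Complex.reCLM.hasFDerivAt (x := conj (f r) * g r)).comp_hasDerivAt r h
  set F : ℝ → ℝ := fun r => (conj (χ r) * N r).re with hF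
  have hFd : ∀ r > a, ∃ F', HasDerivAt F F' r ∧ 0 ≤ F' := by
    intro r hr
    refine ⟨_, hdotd (hχd r hr) (hNd r hr), ?_⟩
    have e1 : (conj (N r / ((p r * w r ^ 2 : ℝ) : ℂ)) * N r + conj (χ r) * ((T r : ℂ) * ψ r))
        = ((Complex.normSq (N r) / (p r * w r ^ 2) + T r * w r * Complex.normSq (χ r) : ℝ) : ℂ) := by
      rw [hψχ r hr, map_div₀, Complex.conj_ofReal]
      push_cast
      rw [Complex.normSq_eq_conj_mul_self, Complex.normSq_eq_conj_mul_self]; ring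
    rw [e1, Complex.ofReal_re]
    have := hp r hr; have := hw r hr; have := hT0 r hr
    have := Complex.normSq_nonneg (N r); have := Complex.normSq_nonneg (χ r)
    positivity
  have hGd : ∀ r > a, HasDerivAt (fun r => Complex.normSq (χ r)) (2 * F r / (p r * w r ^ 2)) r := by
    intro r hr
    have := hdotd (hχd r hr) (hχd r hr)
    have e0 : (fun r => Complex.normSq (χ r)) = fun r => (conj (χ r) * χ r).re := by
      funext r; rw [← Complex.normSq_eq_conj_mul_self, Complex.ofReal_re]
    rw [e0]
    convert this using 1
    have e2 : conj (N r / ((p r * w r ^ 2 : ℝ) : ℂ)) * χ r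
        + conj (χ r) * (N r / ((p r * w r ^ 2 : ℝ) : ℂ))
        = (conj (N r) * χ r + conj (χ r) * N r) / ((p r * w r ^ 2 : ℝ) : ℂ) := by
      rw [map_div₀, Complex.conj_ofReal]; ring
    rw [e2, Complex.div_ofReal_re]
    simp only [hF]
    congr 1
    simp only [Complex.add_re, Complex.mul_re, Complex.conj_re, Complex.conj_im]; ring
  have hmono : ∀ f f' : ℝ → ℝ, ∀ b ≥ a, (∀ r > b, HasDerivAt f (f' r) r) → (∀ r > b, 0 ≤ f' r) →
      MonotoneOn f (Ioi b) := by
    intro f f' b hb hd hn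
    apply monotoneOn_of_deriv_nonneg (convex_Ioi b)
    · exact fun r hr => (hd r hr).continuousAt.continuousWithinAt
    · intro r hr; rw [interior_Ioi] at hr
      exact (hd r hr).differentiableAt.differentiableWithinAt
    · intro r hr; rw [interior_Ioi] at hr
      rw [(hd r hr).deriv]; exact hn r hr
  have hFmono : MonotoneOn F (Ioi a) :=
    hmono F (deriv F) a le_rfl
      (fun r hr => by obtain ⟨F', h, -⟩ := hFd r hr; exact h.differentiableAt.hasDerivAt)
      (fun r hr => by obtain ⟨F', h, h'⟩ := hFd r hr; rw [h.deriv]; exact h')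
  have hGlim : Tendsto (fun r => Complex.normSq (χ r)) atTop (𝓝 0) := by
    have := (Complex.continuous_normSq.tendsto (0:ℂ)).comp hlim
    rw [map_zero] at this
    exact this
  have hFneg : ∀ r > a, F r ≤ 0 := by
    intro b hb
    by_contra! hpos
    have hFp : ∀ r > b, 0 ≤ 2 * F r / (p r * w r ^ 2) := by
      intro r hr
      have hra : a < r := lt_trans hb hr
      have h0 : 0 < F r := lt_of_lt_of_le hpos (hFmono hb hra (le_of_lt hr))
      have := hp r hra; have := hw r hra
      positivity
    have hGm := hmono _ _ b hb.le (fun r hr => hGd r (lt_trans hb hr)) hFp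
    have hχ0 : Complex.normSq (χ (b+1)) ≤ 0 := by
      apply ge_of_tendsto hGlim
      filter_upwards [eventually_ge_atTop (b+1)] with r hr
      exact hGm (by simp) (by simp; linarith) hr
    have h0 : χ (b+1) = 0 := Complex.normSq_eq_zero.1 (le_antisymm hχ0 (Complex.normSq_nonneg _))
    have h1 : F b ≤ F (b+1) := hFmono hb (by simp; linarith [hb.lt]) (by linarith)
    have h2 : F (b+1) = 0 := by simp [hF, h0]
    linarith
  have hNm : MonotoneOn (fun r => -(conj (N r) * N r).re) (Ioi a) := by
    refine hmono _ (fun r => -(conj ((T r : ℂ) * ψ r) * N r + conj (N r) * ((T r : ℂ) * ψ r)).re)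
      a le_rfl (fun r hr => (hdotd (hNd r hr) (hNd r hr)).neg) ?_
    intro r hr
    have e1 : (conj ((T r : ℂ) * ψ r) * N r + conj (N r) * ((T r : ℂ) * ψ r)).re
        = 2 * T r * w r * F r := by
      rw [hψχ r hr]; simp [hF]; ring
    rw [e1]
    have := hw r hr
    have := mul_nonneg (mul_nonneg (hT0 r hr) this.le) (neg_nonneg.2 (hFneg r hr))
    linarith
  have hNb : ∀ r ≥ a+1, ‖N r‖ ≤ ‖N (a+1)‖ := by
    intro r hr
    have := hNm (a := a+1) (b := r) (by simp) (by simp; linarith) hr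
    simp only [← Complex.normSq_eq_conj_mul_self, Complex.ofReal_re, Complex.normSq_eq_norm_sq] at this
    exact le_of_sq_le_sq (by linarith) (norm_nonneg _)
  have hWN : ∀ r > a, (conj (χ r) * N r).im = W0 := by
    intro r hr
    have hw0 : (w r : ℂ) ≠ 0 := by exact_mod_cast (hw r hr).ne'
    rw [← hW r hr]
    have : conj (χ r) * N r = conj (ψ r) * ((p r : ℂ) * dψ r)
        - ((p r * dw r * w r * Complex.normSq (χ r) : ℝ) : ℂ) := by
      simp only [hN]; rw [hψχ r hr]; push_cast
      rw [Complex.normSq_eq_conj_mul_self, map_mul, Complex.conj_ofReal]; ring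
    rw [this, Complex.sub_im, Complex.ofReal_im, sub_zero]
  have hlim2 : Tendsto (fun r => ‖χ r‖ * ‖N (a+1)‖) atTop (𝓝 0) := by
    have := (hlim.norm).mul_const (‖N (a+1)‖)
    simpa using this
  have : |W0| ≤ 0 := by
    apply ge_of_tendsto hlim2
    filter_upwards [eventually_ge_atTop (a+1)] with r hr
    rw [← hWN r (by linarith)]
    refine (Complex.abs_im_le_norm _).trans ?_
    rw [norm_mul, RCLike.norm_conj]
    exact mul_le_mul_of_nonneg_left (hNb r hr) (norm_nonneg _)
  exact abs_nonpos_iff.1 this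

open ComplexConjugate in
/-- On sub-extremal RN–AdS, the only real-mode solutions `φ = e^{iωt}ψ(r)` of the
charged Klein–Gordon equation with Dirichlet boundary condition at infinity and
regular at the horizon are static: if `ω ∈ ℝ` then `ω = 0`. -/
theorem real_mode_is_static (M e Λ α q0 rp : ℝ) (hΛ : Λ < 0)
    (hα1 : -9 / 4 < α) (hα2 : α < 0)
    (Δ : ℝ) (hΔ : Δ = Real.sqrt (9 / 4 + α))
    (Ω2 A : ℝ → ℝ)
    (hΩ2 : ∀ r : ℝ, Ω2 r = 1 - 2 * M / r + e ^ 2 / r ^ 2 + (-Λ / 3) * r ^ 2)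
    (hrp : 0 < rp) (hroot : Ω2 rp = 0) (hT : 0 < deriv Ω2 rp)
    (hpos : ∀ r > rp, 0 < Ω2 r)
    (hA : ∀ r : ℝ, A r = -e * (1 / rp - 1 / r))
    (rstar : ℝ → ℝ) (hrstar : ∀ r > rp, HasDerivAt rstar (1 / Ω2 r) r)
    (ω : ℝ) (ψ : ℝ → ℂ) (hψ : ContDiffOn ℝ 2 ψ (Set.Ioi rp))
    (hode : ∀ r ∈ Set.Ioi rp,
      deriv (fun s : ℝ => (s : ℂ) ^ 2 * (Ω2 s : ℂ) * deriv ψ s) r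
        = (((-Λ / 3) * α - q0 ^ 2 * (A r) ^ 2 / Ω2 r - ω ^ 2 / Ω2 r
            - 2 * q0 * A r * ω / Ω2 r : ℝ) : ℂ) * (r : ℂ) ^ 2 * ψ r)
    (hDir : Tendsto (fun r : ℝ => (r ^ ((3 : ℝ) / 2 - Δ) : ℝ) • ψ r) atTop (𝓝 0))
    (ρ : ℝ → ℂ) (hρ_sm : ContDiffOn ℝ (⊤ : ℕ∞) ρ (Set.Ici rp))
    (hrel : ∀ r > rp, ψ r = Complex.exp (Complex.I * (ω : ℂ) * (rstar r : ℂ)) * ρ r)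
    (hρ0 : ρ rp ≠ 0) :
    ω = 0 := by
  have hΔ2 : Δ ^ 2 = 9 / 4 + α := by rw [hΔ, Real.sq_sqrt (by linarith)]
  have hΔ0 : 0 < Δ := by rw [hΔ]; exact Real.sqrt_pos.2 (by linarith)
  have hΔ3 : Δ < 2 := by nlinarith
  obtain ⟨k, hk⟩ : ∃ k, k = -Λ / 3 := ⟨_, rfl⟩
  have hk0 : 0 < k := by rw [hk]; linarith
  rw [← hk] at hode
  simp only [← hk] at hΩ2
  set p : ℝ → ℝ := fun r => r ^ 2 * Ω2 r with hp
  set V : ℝ → ℝ := fun r => k * α - q0 ^ 2 * (A r) ^ 2 / Ω2 r - ω ^ 2 / Ω2 r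
            - 2 * q0 * A r * ω / Ω2 r with hV
  have hpp : ∀ r > 0, p r = k * r ^ 4 + r ^ 2 - 2 * M * r + e ^ 2 := by
    intro r hr; simp only [hp]; rw [hΩ2]; field_simp; ring
  have hpd : ∀ r > 0, HasDerivAt p (4 * k * r ^ 3 + 2 * r - 2 * M) r := by
    intro r hr
    have h : HasDerivAt (fun r : ℝ => k * r ^ 4 + r ^ 2 - 2 * M * r + e ^ 2)
        (4 * k * r ^ 3 + 2 * r - 2 * M) r := by
      have := ((((hasDerivAt_pow 4 r).const_mul k).add (hasDerivAt_pow 2 r)).sub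
        ((hasDerivAt_id r).const_mul (2 * M))).add_const (e ^ 2)
      refine HasDerivAt.congr_deriv (f := fun r : ℝ => k * r ^ 4 + r ^ 2 - 2 * M * r + e ^ 2) this ?_
      push_cast; ring
    refine h.congr_of_eventuallyEq ?_
    filter_upwards [lt_mem_nhds hr] with s hs using hpp s hs
  have h1 : ∀ r > rp, HasDerivAt ψ (deriv ψ r) r := by
    intro r hr
    exact ((hψ.contDiffAt (Ioi_mem_nhds hr)).differentiableAt (by norm_num)).hasDerivAt
  have hd2 : ∀ r > rp, DifferentiableAt ℝ (deriv ψ) r := by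
    intro r hr
    have : ContDiffOn ℝ 1 (deriv ψ) (Ioi rp) := hψ.deriv_of_isOpen isOpen_Ioi (by norm_num)
    exact (this.contDiffAt (Ioi_mem_nhds hr)).differentiableAt (by norm_num)
  have h2 : ∀ r > rp, HasDerivAt (fun r => (p r : ℂ) * deriv ψ r)
      (((V r * r ^ 2 : ℝ) : ℂ) * ψ r) r := by
    intro r hr
    have h := ((hpd r (hrp.trans hr)).ofReal_comp.mul (hd2 r hr).hasDerivAt)
    have h' := h.differentiableAt.hasDerivAt
    have e1 : (fun s : ℝ => (s : ℂ) ^ 2 * (Ω2 s : ℂ) * deriv ψ s)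
      = fun r => (p r : ℂ) * deriv ψ r := by
      funext s; simp only [hp]; push_cast; ring
    have h3 := hode r hr
    rw [e1] at h3
    have h4 : DifferentiableAt ℝ (fun r => (p r : ℂ) * deriv ψ r) r := h.differentiableAt
    have h5 := h4.hasDerivAt
    rw [h3] at h5
    refine h5.congr_deriv ?_
    simp only [hV]; push_cast; ring
  -- constancy of the flux
  set W : ℝ → ℝ := fun r => (conj (ψ r) * ((p r : ℂ) * deriv ψ r)).im with hW
  have hWd : ∀ r > rp, HasDerivAt W 0 r := by
    intro r hr
    have h := ((h1 r hr).star).mul (h2 r hr)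
    have h' := (Complex.imCLM.hasFDerivAt (x := conj (ψ r) * ((p r : ℂ) * deriv ψ r))).comp_hasDerivAt r h
    refine HasDerivAt.congr_deriv (f := W) h' ?_
    generalize V r * r ^ 2 = v
    simp; ring
  have hWc : ∀ r > rp, W r = W (rp + 1) := by
    intro r hr
    refine (convex_Ioi rp).is_const_of_fderivWithin_eq_zero (𝕜 := ℝ) (f := W) ?_ ?_ hr (by simp)
    · exact fun x hx => (hWd x hx).differentiableAt.differentiableWithinAt
    · intro x hx
      rw [fderivWithin_of_isOpen isOpen_Ioi hx]
      ext; simp [(hWd x hx).deriv]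
  -- flux at the horizon
  have hhor : Tendsto W (𝓝[>] rp) (𝓝 (rp ^ 2 * (ω * Complex.normSq (ρ rp)))) := by
    have hΩc : ContinuousAt Ω2 rp := by
      by_contra hc
      rw [deriv_zero_of_not_differentiableAt (fun h => hc h.continuousAt)] at hT
      exact lt_irrefl _ hT
    have hΩt : Tendsto Ω2 (𝓝[>] rp) (𝓝 0) := by
      have := hΩc.tendsto; rw [hroot] at this; exact this.mono_left nhdsWithin_le_nhds
    have hρt : Tendsto ρ (𝓝[>] rp) (𝓝 (ρ rp)) :=
      (hρ_sm.continuousOn rp (by simp)).tendsto.mono_left (nhdsWithin_mono _ Ioi_subset_Ici_self)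
    have hρ't : Tendsto (derivWithin ρ (Ici rp)) (𝓝[>] rp) (𝓝 (derivWithin ρ (Ici rp) rp)) :=
      (hρ_sm.continuousOn_derivWithin (uniqueDiffOn_Ici rp) (by norm_cast) rp
        (by simp)).tendsto.mono_left (nhdsWithin_mono _ Ioi_subset_Ici_self)
    have hrt : Tendsto (fun r : ℝ => r) (𝓝[>] rp) (𝓝 rp) := nhdsWithin_le_nhds
    have hlim : Tendsto (fun r => r ^ 2 * (ω * Complex.normSq (ρ r)
        + Ω2 r * (conj (ρ r) * derivWithin ρ (Ici rp) r).im)) (𝓝[>] rp)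
        (𝓝 (rp ^ 2 * (ω * Complex.normSq (ρ rp)
        + 0 * (conj (ρ rp) * derivWithin ρ (Ici rp) rp).im))) := by
      refine (hrt.pow 2).mul (Tendsto.add ?_ ?_)
      · exact ((Complex.continuous_normSq.tendsto _).comp hρt).const_mul ω
      · refine hΩt.mul ?_
        exact (Complex.continuous_im.tendsto _).comp
          (((Complex.continuous_conj.tendsto _).comp hρt).mul hρ't)
    rw [zero_mul, add_zero] at hlim
    refine hlim.congr' ?_
    filter_upwards [self_mem_nhdsWithin] with r hr
    have hr : rp < r := hr
    have hρd : HasDerivAt ρ (derivWithin ρ (Ici rp) r) r := by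
      have h : DifferentiableAt ℝ ρ r :=
        (hρ_sm.contDiffAt (Ici_mem_nhds hr)).differentiableAt (by simp)
      rw [derivWithin_of_mem_nhds (Ici_mem_nhds hr)]
      exact h.hasDerivAt
    set E : ℂ := Complex.exp (Complex.I * (ω : ℂ) * (rstar r : ℂ)) with hE
    have hEE : conj E * E = 1 := by
      rw [← Complex.normSq_eq_conj_mul_self, Complex.normSq_eq_norm_sq, hE, Complex.norm_exp]
      simp
    have hEd := (((hrstar r hr).ofReal_comp.const_mul (Complex.I * (ω : ℂ))).cexp).mul hρd
    have hψd : deriv ψ r = E * (Complex.I * ω * ((1 / Ω2 r : ℝ) : ℂ)) * ρ r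
        + E * derivWithin ρ (Ici rp) r := by
      refine HasDerivAt.deriv (hEd.congr_of_eventuallyEq ?_)
      filter_upwards [Ioi_mem_nhds hr] with s hs using hrel s hs
    have hΩ0 : (Ω2 r : ℂ) ≠ 0 := by exact_mod_cast (hpos r hr).ne'
    have : conj (ψ r) * ((p r : ℂ) * deriv ψ r) = ((r ^ 2 : ℝ) : ℂ) *
      (((ω * Complex.normSq (ρ r) : ℝ) : ℂ) * Complex.I
        + (Ω2 r : ℂ) * (conj (ρ r) * derivWithin ρ (Ici rp) r)) := by
      rw [hψd, hrel r hr, ← hE, map_mul]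
      simp only [hp]
      push_cast
      rw [Complex.normSq_eq_conj_mul_self]
      field_simp
      linear_combination (r ^ 2 * conj (ρ r) * (ρ r * Complex.I * ω
        + Ω2 r * derivWithin ρ (Ici rp) r) : ℂ) * hEE
    simp only [hW]
    rw [this, Complex.im_ofReal_mul, Complex.add_im, Complex.im_ofReal_mul, Complex.im_ofReal_mul,
      Complex.I_im, mul_one]
  have hfin : W (rp + 1) = rp ^ 2 * (ω * Complex.normSq (ρ rp)) := by
    refine tendsto_nhds_unique ?_ hhor
    refine tendsto_const_nhds.congr' ?_
    filter_upwards [self_mem_nhdsWithin] with r hr using (hWc r hr).symm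
  suffices hz : W (rp + 1) = 0 by
    rw [hz] at hfin
    have h3 : Complex.normSq (ρ rp) ≠ 0 := fun h => hρ0 (Complex.normSq_eq_zero.1 h)
    have h4 := hrp.ne'
    simpa [h4, hρ0] using hfin.symm
  -- the supersolution
  obtain ⟨s, hs⟩ : ∃ s, s = 3 / 2 - Δ := ⟨_, rfl⟩
  rw [← hs] at hDir
  set w : ℝ → ℝ := fun r => r ^ (-s) + r ^ (-(3 / 2) : ℝ) with hw
  set dw : ℝ → ℝ := fun r => (-s) * r ^ (-s - 1) + (-(3 / 2)) * r ^ (-(3 / 2) - 1 : ℝ) with hdw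
  set ddw : ℝ → ℝ := fun r => (-s) * ((-s - 1) * r ^ (-s - 1 - 1))
    + (-(3 / 2)) * ((-(3 / 2) - 1 : ℝ) * r ^ (-(3 / 2) - 1 - 1 : ℝ)) with hddw
  have hwd : ∀ r > 0, HasDerivAt w (dw r) r := fun r hr =>
    (Real.hasDerivAt_rpow_const (Or.inl hr.ne')).add (Real.hasDerivAt_rpow_const (Or.inl hr.ne'))
  have hdwd : ∀ r > 0, HasDerivAt dw (ddw r) r := fun r hr =>
    ((Real.hasDerivAt_rpow_const (Or.inl hr.ne')).const_mul _).add
      ((Real.hasDerivAt_rpow_const (Or.inl hr.ne')).const_mul _)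
  have hwpos : ∀ r > 0, 0 < w r := fun r hr => by simp only [hw]; positivity
  have hy : Tendsto (fun r : ℝ => r ^ (Δ - 2)) atTop (𝓝 0) := by
    have := tendsto_rpow_neg_atTop (y := 2 - Δ) (by linarith)
    simpa using this
  have hu : Tendsto (fun r : ℝ => r⁻¹) atTop (𝓝 0) := tendsto_inv_atTop_zero
  set Φ : ℝ × ℝ → ℝ := fun x => k * Δ ^ 2
      - (q0 * (-e * (1 / rp - x.1)) + ω) ^ 2 * (x.2 + x.1 ^ 2)
          / (k + x.1 ^ 2 - 2 * M * x.1 ^ 3 + e ^ 2 * x.1 ^ 4)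
      + (2 - 2 * M * x.1) * (s * x.2 + 3 / 2 * x.1 ^ 2)
      - (1 - 2 * M * x.1 + e ^ 2 * x.1 ^ 2) * (s * (s + 1) * x.2 + 15 / 4 * x.1 ^ 2) with hΦ
  have hΦc : ContinuousAt Φ (0, 0) := by
    have : k + (0:ℝ) ^ 2 - 2 * M * 0 ^ 3 + e ^ 2 * 0 ^ 4 ≠ 0 := by simp [hk0.ne']
    simp only [hΦ]
    fun_prop (disch := simpa using hk0.ne')
  have hΦ0 : 0 < Φ (0, 0) := by
    simp only [hΦ]; norm_num; positivity
  have hev : ∀ᶠ r : ℝ in atTop, 0 < Φ (r⁻¹, r ^ (Δ - 2)) :=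
    (hΦc.tendsto.comp (hu.prodMk_nhds hy)).eventually (lt_mem_nhds hΦ0)
  obtain ⟨a, ha⟩ := eventually_atTop.1 (hev.and (eventually_gt_atTop rp))
  refine flux_zero a (W (rp + 1)) p w dw
    (fun r => (4 * k * r ^ 3 + 2 * r - 2 * M) * dw r + p r * ddw r)
    (fun r => V r * r ^ 2) ψ (deriv ψ) (fun r hr => h1 r (ha r hr.le).2)
    (fun r hr => h2 r (ha r hr.le).2) (fun r hr => hwd r (hrp.trans (ha r hr.le).2))
    (fun r hr => (hpd r (hrp.trans (ha r hr.le).2)).mul (hdwd r (hrp.trans (ha r hr.le).2))) ?_ ?_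
    (fun r hr => hwpos r (hrp.trans (ha r hr.le).2)) ?_ (fun r hr => hWc r (ha r hr.le).2)
  · intro r hr
    obtain ⟨hΦr, hrr⟩ := ha r hr.le
    have hr0 : 0 < r := hrp.trans hrr
    have hΩp := hpos r hrr
    obtain ⟨g, hg⟩ : ∃ g, g = r ^ (-(3 / 2) : ℝ) := ⟨_, rfl⟩
    obtain ⟨x, hx⟩ : ∃ x, x = r ^ (Δ - 2) := ⟨_, rfl⟩
    have hg0 : 0 < g := by rw [hg]; positivity
    have hgs : r ^ (-s) = g * x * r ^ 2 := by
      rw [hg, hx, ← Real.rpow_natCast, ← Real.rpow_add hr0, ← Real.rpow_add hr0]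
      congr 1; push_cast; rw [hs]; ring
    have hw1 : w r = g * (x * r ^ 2 + 1) := by simp only [hw]; rw [hgs, ← hg]; ring
    have hdw1 : dw r = - g * (s * x * r ^ 2 + 3 / 2) / r := by
      simp only [hdw]
      rw [Real.rpow_sub_one hr0.ne', Real.rpow_sub_one hr0.ne', hgs, ← hg]; ring
    have hddw1 : ddw r = g * (s * (s + 1) * x * r ^ 2 + 15 / 4) / r ^ 2 := by
      simp only [hddw]
      rw [Real.rpow_sub_one hr0.ne', Real.rpow_sub_one hr0.ne', Real.rpow_sub_one hr0.ne',
        Real.rpow_sub_one hr0.ne', hgs, ← hg]; field_simp; ring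
    rw [← hx] at hΦr
    have hB : k + (r⁻¹) ^ 2 - 2 * M * (r⁻¹) ^ 3 + e ^ 2 * (r⁻¹) ^ 4 = Ω2 r / r ^ 2 := by
      rw [hΩ2]; field_simp; ring
    have hα : α = - s * (3 - s) := by rw [hs]; linarith
    have hΔs : Δ = 3 / 2 - s := by rw [hs]; ring
    have hV1 : V r = k * α - (q0 * (-e * (1 / rp - r⁻¹)) + ω) ^ 2 / Ω2 r := by
      simp only [hV]; rw [hA, one_div r]; ring
    have key : V r * r ^ 2 * w r - ((4 * k * r ^ 3 + 2 * r - 2 * M) * dw r + p r * ddw r)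
        = g * r ^ 2 * Φ (r⁻¹, x) := by
      simp only [hΦ]
      rw [hB, hV1, hw1, hdw1, hddw1, hpp r hr0, hα, hΔs]
      generalize q0 * (-e * (1 / rp - r⁻¹)) + ω = Y
      generalize Ω2 r = O at hΩp
      field_simp
      ring
    have : 0 < g * r ^ 2 * Φ (r⁻¹, x) := by positivity
    linarith
  · intro r hr
    have := hpos r (ha r hr.le).2
    have := hrp.trans (ha r hr.le).2
    simp only [hp]; positivity
  · refine squeeze_zero_norm' ?_ (tendsto_zero_iff_norm_tendsto_zero.1 hDir)
    filter_upwards [eventually_gt_atTop 0] with r hr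
    have hwr := hwpos r hr
    rw [norm_div, Complex.norm_real, Real.norm_of_nonneg hwr.le, div_le_iff₀ hwr, norm_smul,
      Real.norm_of_nonneg (Real.rpow_nonneg hr.le s)]
    have : 1 ≤ r ^ s * w r := by
      simp only [hw]
      rw [mul_add, ← Real.rpow_add hr, add_neg_cancel, Real.rpow_zero]
      have : 0 < r ^ s * r ^ (-(3 / 2) : ℝ) := by positivity
      linarith
    nlinarith [norm_nonneg (ψ r)]
end

section
/- Every growing mode solution φ = e^{iωt}ψ(r), Im(ω) < 0, of the uncharged (q₀ = 0) Klein–Gordon equation on a sub-extremal Reissner–Nordström–AdS spacetime, regular at the horizon and satisfying a reflecting boundary condition, has purely imaginary frequency ω: writing ω = ω_R + iω_I with ω_I < 0, one has ω_R = 0. -/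
open Set Filter Topology Real

lemma aux_horizon (rp B δ : ℝ) (hδ : 0 < δ) (hB : 0 < B) (P P' : ℝ → ℝ) (ψ ψ' v v' : ℝ → ℂ)
    (hP : ∀ s ∈ Ioo rp (rp + δ), HasDerivAt P (P' s) s)
    (hψ : ∀ s ∈ Ioo rp (rp + δ), HasDerivAt ψ (ψ' s) s)
    (hv : ∀ s ∈ Ioo rp (rp + δ), HasDerivAt v (v' s) s)
    (hvP : ∀ s ∈ Ioo rp (rp + δ), v s = (P s : ℂ) * ψ' s)
    (hP'B : ∀ s ∈ Ioo rp (rp + δ), |P' s| ≤ B)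
    (hPB : ∀ s ∈ Ioo rp (rp + δ), |P s| ≤ B * (s - rp))
    (hv' : ∀ s ∈ Ioo rp (rp + δ), ‖v' s‖ ≤ B / (s - rp) * ‖ψ s‖)
    (h0 : Tendsto ψ (𝓝[>] rp) (𝓝 0)) : Tendsto v (𝓝[>] rp) (𝓝 0) := by
  rw [Metric.tendsto_nhds]
  intro ε0 hε0
  set ε := ε0 / (10 * B) with hε
  have hεp : 0 < ε := by positivity
  have h1 : ∀ᶠ s in 𝓝[>] rp, ‖ψ s‖ < ε := by
    have := (Metric.tendsto_nhds.1 h0) ε hεp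
    simpa using this
  rw [Filter.Eventually, mem_nhdsGT_iff_exists_Ioo_subset] at h1
  obtain ⟨b, hb, hsub⟩ := h1
  have hb' : rp < b := hb
  set d := min (b - rp) δ with hd
  have hdpos : 0 < d := lt_min (by linarith) hδ
  have hdδ : d ≤ δ := min_le_right _ _
  have hdb : d ≤ b - rp := min_le_left _ _
  have : Ioo rp (rp + d / 2) ∈ 𝓝[>] rp := Ioo_mem_nhdsGT (by linarith)
  filter_upwards [this] with r hr
  obtain ⟨hr1, hr2⟩ := hr
  set h := r - rp with hh
  have hhp : 0 < h := by linarith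
  have hin : ∀ s ∈ Icc r (r + h), s ∈ Ioo rp (rp + δ) := fun s hs => ⟨by linarith [hs.1], by linarith [hs.2]⟩
  have hsm : ∀ s ∈ Icc r (r + h), ‖ψ s‖ ≤ ε := fun s hs =>
    le_of_lt (hsub ⟨by linarith [hs.1], by linarith [hs.2]⟩)
  have hrI : r ∈ Icc r (r + h) := ⟨le_refl _, by linarith⟩
  have hrE : r + h ∈ Icc r (r + h) := ⟨by linarith, le_refl _⟩
  have hvd : ∀ s ∈ Icc r (r + h), ‖v s - v r‖ ≤ B * ε := by
    intro s hs
    have := (convex_Icc r (r + h)).norm_image_sub_le_of_norm_hasDerivWithin_le (f := v) (f' := v')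
      (C := B / h * ε) (fun x hx => (hv x (hin x hx)).hasDerivWithinAt) (fun x hx => by
        refine (hv' x (hin x hx)).trans ?_
        have := hsm x hx
        have : B / (x - rp) ≤ B / h := by
          apply div_le_div_of_nonneg_left hB.le hhp; linarith [hx.1]
        gcongr) hrI hs
    refine this.trans ?_
    rw [Real.norm_eq_abs, abs_of_nonneg (by linarith [hs.1])]
    calc B / h * ε * (s - r) ≤ B / h * ε * h := by gcongr; linarith [hs.2]
      _ = B * ε := by field_simp
  have hN := (convex_Icc r (r + h)).norm_image_sub_le_of_norm_hasDerivWithin_le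
      (f := fun s : ℝ => (P s : ℂ) * ψ s - v r * (s : ℂ))
      (f' := fun s => ((P' s : ℂ) * ψ s + (P s : ℂ) * ψ' s) - v r * 1)
      (C := 2 * B * ε) (fun x hx => by
        have a1 := (hP x (hin x hx)).ofReal_comp
        have a2 := a1.mul (hψ x (hin x hx))
        have a3 := ((hasDerivAt_id x).ofReal_comp).const_mul (v r)
        exact (a2.sub (by simpa using a3)).hasDerivWithinAt) (fun x hx => by
        rw [← hvP x (hin x hx)]
        have e1 : (P' x : ℂ) * ψ x + v x - v r * 1 = (P' x : ℂ) * ψ x + (v x - v r) := by ring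
        rw [e1]
        refine (norm_add_le _ _).trans ?_
        have := hvd x hx
        have : ‖(P' x : ℂ) * ψ x‖ ≤ B * ε := by
          rw [norm_mul, Complex.norm_real, Real.norm_eq_abs]
          exact mul_le_mul (hP'B x (hin x hx)) (hsm x hx) (norm_nonneg _) hB.le
        linarith) hrI hrE
  have hPb : ∀ s ∈ Icc r (r + h), ‖(P s : ℂ) * ψ s‖ ≤ B * (s - rp) * ε := by
    intro s hs
    rw [norm_mul, Complex.norm_real, Real.norm_eq_abs]
    exact mul_le_mul (hPB s (hin s hs)) (hsm s hs) (norm_nonneg _)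
      (mul_nonneg hB.le (by linarith [hs.1]))
  have b1 := hPb _ hrI
  have b2 := hPb _ hrE
  have e2 : v r * (h : ℂ) = (P (r + h) : ℂ) * ψ (r + h) - (P r : ℂ) * ψ r -
      (((P (r + h) : ℂ) * ψ (r + h) - v r * ((r + h : ℝ) : ℂ)) - ((P r : ℂ) * ψ r - v r * (r : ℂ))) := by
    push_cast; ring
  have e3 : ‖v r‖ * h ≤ 5 * B * ε * h := by
    have : ‖v r * (h : ℂ)‖ = ‖v r‖ * h := by
      rw [norm_mul, Complex.norm_real, Real.norm_eq_abs, abs_of_pos hhp]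
    rw [← this, e2]
    refine (norm_sub_le _ _).trans ?_
    have := norm_sub_le ((P (r + h) : ℂ) * ψ (r + h)) ((P r : ℂ) * ψ r)
    rw [show ‖r + h - r‖ = h by simp [abs_of_pos hhp]] at hN
    have e5 : r + h - rp = 2 * h := by rw [hh]; ring
    rw [e5] at b2
    rw [← hh] at b1
    linarith
  have e4 : ‖v r‖ ≤ 5 * B * ε := le_of_mul_le_mul_right e3 hhp
  have e6 : 5 * B * ε = ε0 / 2 := by rw [hε]; field_simp; norm_num
  rw [dist_zero_right]
  linarith

lemma aux_int (R C p : ℝ) (hR : 0 < R) (hp : 0 < p) (hC : 0 ≤ C) (u u' : ℝ → ℂ)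
    (hu : ∀ r ≥ R, HasDerivAt u (u' r) r) (hb : ∀ r ≥ R, ‖u' r‖ ≤ C * r ^ (-p - 1))
    (r x : ℝ) (hr : R ≤ r) (hx : r ≤ x) : ‖u x - u r‖ ≤ C / p * r ^ (-p) := by
  have key := image_norm_le_of_norm_deriv_right_le_deriv_boundary' (a := r) (b := x)
    (f := fun s => u s - u r) (f' := u') (B := fun s => C / p * (r ^ (-p) - s ^ (-p)))
    (B' := fun s => C * s ^ (-p - 1))
    (fun s hs => ((hu s (hr.trans hs.1)).continuousAt.sub continuousAt_const).continuousWithinAt)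
    (fun s hs => ((hu s (hr.trans hs.1)).sub_const _).hasDerivWithinAt)
    (by simp)
    (fun s hs => by
      have : s ≠ 0 := by linarith [hs.1]
      exact ((continuousAt_const.sub (Real.continuousAt_rpow_const _ _ (Or.inl this))).const_mul _).continuousWithinAt)
    (fun s hs => by
      have : s ≠ 0 := by linarith [hs.1]
      have := ((Real.hasDerivAt_rpow_const (p := -p) (Or.inl this)).const_sub (r ^ (-p))).const_mul (C / p)
      refine (this.congr_deriv ?_).hasDerivWithinAt
      field_simp)
    (fun s hs => hb s (hr.trans hs.1)) (x := x) ⟨hx, le_refl _⟩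
  refine key.trans ?_
  have : 0 ≤ x ^ (-p) := Real.rpow_nonneg (by linarith) _
  gcongr
  linarith

lemma aux_infty (Δ R C : ℝ) (hΔ : 0 < Δ) (hΔ2 : Δ < 3 / 2) (hR : 1 ≤ R) (hC : 0 ≤ C)
    (u u' w w' : ℝ → ℂ)
    (hu : ∀ r ≥ R, HasDerivAt u (u' r) r) (hw : ∀ r ≥ R, HasDerivAt w (w' r) r)
    (hub : ∀ r ≥ R, ‖u' r‖ ≤ C * r ^ (-2 * Δ - 1) * ‖w r‖)
    (hwb : ∀ r ≥ R, ‖w' r‖ ≤ C * r ^ (2 * Δ - 3) * ‖u r‖)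
    (hu0 : Tendsto u atTop (𝓝 0)) : ∃ B, ∀ᶠ r in atTop, ‖w r‖ ≤ B := by
  have h1 : ∀ᶠ r in atTop, ‖u r‖ < 1 := by
    have := (Metric.tendsto_nhds.1 hu0) 1 one_pos
    simpa using this
  obtain ⟨R1, hR1⟩ := eventually_atTop.1 h1
  set S := max R R1
  have hS : R ≤ S := le_max_left _ _
  have hS1 : 1 ≤ S := hR.trans hS
  have hu1 : ∀ r ≥ S, ‖u r‖ ≤ 1 := fun r hr => (hR1 r ((le_max_right _ _).trans hr)).le
  suffices h : ∃ D, 0 ≤ D ∧ ∀ r ≥ S, ‖w' r‖ ≤ D * r ^ (-(1:ℝ) - 1) by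
    obtain ⟨D, hD, hw2⟩ := h
    refine ⟨‖w S‖ + D / 1 * S ^ (-(1:ℝ)), eventually_atTop.2 ⟨S, fun r hr => ?_⟩⟩
    have := aux_int S D 1 (by linarith) one_pos hD w w' (fun r hr => hw r (hS.trans hr)) hw2 S r le_rfl hr
    have := norm_le_norm_add_norm_sub' (w r) (w S)
    linarith
  rcases le_or_gt Δ (1 / 2) with hd | hd
  · refine ⟨C, hC, fun r hr => (hwb r (hS.trans hr)).trans ?_⟩
    have hr1 : 1 ≤ r := hS1.trans hr
    have h2 : r ^ (2 * Δ - 3) ≤ r ^ (-(1:ℝ) - 1) := Real.rpow_le_rpow_of_exponent_le hr1 (by linarith)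
    have := hu1 r hr
    have h3 : 0 ≤ C * r ^ (2 * Δ - 3) := by positivity
    calc _ ≤ C * r ^ (2 * Δ - 3) * 1 := by gcongr
      _ ≤ _ := by rw [mul_one]; gcongr
  · have hw1 : ∀ r ≥ S, ‖w' r‖ ≤ C := by
      intro r hr
      refine (hwb r (hS.trans hr)).trans ?_
      have hr1 : 1 ≤ r := hS1.trans hr
      have h2 : r ^ (2 * Δ - 3) ≤ 1 := Real.rpow_le_one_of_one_le_of_nonpos hr1 (by linarith)
      have := hu1 r hr
      have h0 : 0 ≤ r ^ (2 * Δ - 3) := by positivity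
      calc _ ≤ C * 1 * 1 := by gcongr
        _ = _ := by ring
    have hw2 : ∀ r ≥ S, ‖w r‖ ≤ (‖w S‖ + C) * r := by
      intro r hr
      have hr1 : 1 ≤ r := hS1.trans hr
      have := (convex_Ici S).norm_image_sub_le_of_norm_hasDerivWithin_le (f := w) (f' := w') (C := C)
        (fun x hx => (hw x (hS.trans hx)).hasDerivWithinAt) (fun x hx => hw1 x hx)
        (x := S) (y := r) (mem_Ici.2 le_rfl) hr
      have h4 := norm_le_norm_add_norm_sub' (w r) (w S)
      rw [Real.norm_eq_abs, abs_of_nonneg (by linarith [show S ≤ r from hr])] at this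
      have h5 : 0 ≤ ‖w S‖ := norm_nonneg _
      nlinarith [mul_nonneg hC (by linarith : (0:ℝ) ≤ S)]
    set D := C * (‖w S‖ + C) with hD
    have hD0 : 0 ≤ D := by positivity
    have hu2 : ∀ r ≥ S, ‖u' r‖ ≤ D * r ^ (-(2 * Δ - 1) - 1) := by
      intro r hr
      have hr1 : 1 ≤ r := hS1.trans hr
      refine (hub r (hS.trans hr)).trans ?_
      have e : r ^ (-(2 * Δ - 1) - 1) = r ^ (-2 * Δ - 1) * r := by
        rw [← Real.rpow_add_one (by linarith)]; congr 1; ring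
      rw [e]
      calc _ ≤ C * r ^ (-2 * Δ - 1) * ((‖w S‖ + C) * r) := by gcongr; exact hw2 r hr
        _ = _ := by rw [hD]; ring
    have hu3 : ∀ r ≥ S, ‖u r‖ ≤ D / (2 * Δ - 1) * r ^ (-(2 * Δ - 1)) := by
      intro r hr
      have ht : Tendsto (fun x => ‖u x - u r‖) atTop (𝓝 ‖0 - u r‖) := (hu0.sub_const _).norm
      rw [zero_sub, norm_neg] at ht
      refine le_of_tendsto ht (eventually_atTop.2 ⟨r, fun x hx => ?_⟩)
      exact aux_int S D (2 * Δ - 1) (by linarith) (by linarith) hD0 u u'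
        (fun r hr => hu r (hS.trans hr)) hu2 r x hr hx
    refine ⟨C * (D / (2 * Δ - 1)), mul_nonneg hC (div_nonneg hD0 (by linarith)), fun r hr => (hwb r (hS.trans hr)).trans ?_⟩
    have hr1 : 1 ≤ r := hS1.trans hr
    have e : r ^ (-(1:ℝ) - 1) = r ^ (2 * Δ - 3) * r ^ (-(2 * Δ - 1)) := by
      rw [← Real.rpow_add (by linarith)]; congr 1; ring
    rw [e]
    calc _ ≤ C * r ^ (2 * Δ - 3) * (D / (2 * Δ - 1) * r ^ (-(2 * Δ - 1))) := by gcongr; exact hu3 r hr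
      _ = _ := by ring

lemma aux_mono (rp k : ℝ) (hk : k ≠ 0) (F g : ℝ → ℝ) (hg : ∀ r ∈ Ioi rp, 0 ≤ g r)
    (hF : ∀ r ∈ Ioi rp, HasDerivAt F (k * g r) r)
    (h0 : Tendsto F (𝓝[>] rp) (𝓝 0)) (h1 : Tendsto F atTop (𝓝 0)) : ∀ r ∈ Ioi rp, g r = 0 := by
  set G := fun r => k * F r with hG
  have hGd : ∀ r ∈ Ioi rp, HasDerivAt G (k ^ 2 * g r) r := fun r hr =>
    ((hF r hr).const_mul k).congr_deriv (by ring)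
  have hm : MonotoneOn G (Ioi rp) := by
    apply monotoneOn_of_hasDerivWithinAt_nonneg (f' := fun r => k ^ 2 * g r) (convex_Ioi rp)
    · exact fun r hr => (hGd r hr).continuousAt.continuousWithinAt
    · intro r hr; rw [interior_Ioi] at hr; exact (hGd r hr).hasDerivWithinAt
    · intro r hr; rw [interior_Ioi] at hr; exact mul_nonneg (sq_nonneg _) (hg r hr)
  have t0 : Tendsto G (𝓝[>] rp) (𝓝 0) := by simpa using h0.const_mul k
  have t1 : Tendsto G atTop (𝓝 0) := by simpa using h1.const_mul k
  have hz : ∀ r ∈ Ioi rp, G r = 0 := by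
    intro r hr
    apply le_antisymm
    · exact ge_of_tendsto t1 (eventually_atTop.2 ⟨r, fun x hx => hm hr (lt_of_lt_of_le hr hx) hx⟩)
    · refine le_of_tendsto t0 ?_
      filter_upwards [Ioo_mem_nhdsGT hr] with x hx
      exact hm hx.1 hr hx.2.le
  intro r hr
  have : HasDerivAt G 0 r := (hasDerivAt_const r (0:ℝ)).congr_of_eventuallyEq (by
    filter_upwards [Ioi_mem_nhds hr] with x hx using hz x hx)
  have := (hGd r hr).unique this
  simpa [hk] using this

lemma aux_growth (M e c : ℝ) (hc : 0 < c) (Ω2 : ℝ → ℝ)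
    (hΩ2 : ∀ r : ℝ, Ω2 r = 1 - 2 * M / r + e ^ 2 / r ^ 2 + c * r ^ 2) :
    Tendsto (fun r => Ω2 r / r ^ 2) atTop (𝓝 c) := by
  have hi : Tendsto (fun r : ℝ => r⁻¹) atTop (𝓝 0) := tendsto_inv_atTop_zero
  have h : Tendsto (fun r : ℝ => (r⁻¹) ^ 2 - 2 * M * (r⁻¹) ^ 3 + e ^ 2 * (r⁻¹) ^ 4 + c) atTop
      (𝓝 (0 ^ 2 - 2 * M * 0 ^ 3 + e ^ 2 * 0 ^ 4 + c)) :=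
    (((hi.pow 2).sub ((hi.pow 3).const_mul _)).add ((hi.pow 4).const_mul _)).add_const c
  have h' := h.congr' (f₂ := fun r => Ω2 r / r ^ 2) (by
    filter_upwards [eventually_gt_atTop 0] with r hr
    rw [hΩ2]; field_simp)
  simpa using h'

theorem uncharged_growing_mode_pure_imaginary (M e Λ α rp : ℝ) (hΛ : Λ < 0)
    (hα1 : -9 / 4 < α) (hα2 : α < 0)
    (Δ : ℝ) (hΔ : Δ = Real.sqrt (9 / 4 + α))
    (Ω2 : ℝ → ℝ)
    (hΩ2 : ∀ r : ℝ, Ω2 r = 1 - 2 * M / r + e ^ 2 / r ^ 2 + (-Λ / 3) * r ^ 2)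
    (hrp : 0 < rp) (hroot : Ω2 rp = 0) (hT : 0 < deriv Ω2 rp)
    (hpos : ∀ r > rp, 0 < Ω2 r)
    (ω : ℂ) (hω : ω.im < 0)
    (ψ : ℝ → ℂ) (hψ : ContDiffOn ℝ 2 ψ (Set.Ioi rp))
    (hode : ∀ r ∈ Set.Ioi rp,
      deriv (fun s : ℝ => (s : ℂ) ^ 2 * (Ω2 s : ℂ) * deriv ψ s) r
        = ((((-Λ / 3) * α : ℝ) : ℂ) - ω ^ 2 / ((Ω2 r : ℝ) : ℂ)) * (r : ℂ) ^ 2 * ψ r)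
    (hhor : Tendsto ψ (𝓝[>] rp) (𝓝 0))
    (hbc : Tendsto (fun r : ℝ => (r ^ ((3 : ℝ) / 2 - Δ) : ℝ) • ψ r) atTop (𝓝 0)
      ∨ Tendsto (fun r : ℝ =>
          (r ^ (2 * Δ + 1) : ℝ) •
            deriv (fun s : ℝ => (s ^ ((3 : ℝ) / 2 - Δ) : ℝ) • ψ s) r) atTop (𝓝 0))
    (hnt : ∃ r ∈ Set.Ioi rp, ψ r ≠ 0) :
    ω.re = 0 := by
  have hc : 0 < -Λ / 3 := by linarith
  set c := -Λ / 3 with hcdef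
  clear_value c
  have hΔ0 : 0 < Δ := by rw [hΔ]; exact Real.sqrt_pos.2 (by linarith)
  have hΔsq : Δ ^ 2 = 9 / 4 + α := by rw [hΔ]; exact Real.sq_sqrt (by linarith)
  have hΔ2 : Δ < 3 / 2 := by nlinarith
  -- basic derivatives
  have hP0 : ∀ s : ℝ, 0 < s → s ^ 2 * Ω2 s = c * s ^ 4 + s ^ 2 - 2 * M * s + e ^ 2 := by
    intro s hs; rw [hΩ2]; field_simp; ring
  have hPd0 : ∀ s : ℝ, HasDerivAt (fun s : ℝ => c * s ^ 4 + s ^ 2 - 2 * M * s + e ^ 2)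
      (4 * c * s ^ 3 + 2 * s - 2 * M) s := by
    intro s
    have := ((((hasDerivAt_pow 4 s).const_mul c).add (hasDerivAt_pow 2 s)).sub
      ((hasDerivAt_id s).const_mul (2 * M))).add_const (e ^ 2)
    refine this.congr_deriv ?_
    norm_num; ring
  have hPd : ∀ s : ℝ, 0 < s → HasDerivAt (fun s : ℝ => s ^ 2 * Ω2 s)
      (4 * c * s ^ 3 + 2 * s - 2 * M) s := by
    intro s hs
    refine (hPd0 s).congr_of_eventuallyEq ?_
    filter_upwards [Ioi_mem_nhds hs] with x hx using hP0 x hx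
  have hψ1 : ∀ r ∈ Ioi rp, HasDerivAt ψ (deriv ψ r) r := fun r hr =>
    ((hψ.differentiableOn (by norm_num)).differentiableAt (Ioi_mem_nhds hr)).hasDerivAt
  have hψ2 : ∀ r ∈ Ioi rp, DifferentiableAt ℝ (deriv ψ) r := by
    have h2 : ContDiffOn ℝ 1 (deriv ψ) (Ioi rp) :=
      ((contDiffOn_succ_iff_deriv_of_isOpen (n := 1) isOpen_Ioi).1 (by simpa [one_add_one_eq_two] using hψ)).2.2
    exact fun r hr => (h2.differentiableOn (by norm_num)).differentiableAt (Ioi_mem_nhds hr)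
  set v : ℝ → ℂ := fun s : ℝ => (s : ℂ) ^ 2 * (Ω2 s : ℂ) * deriv ψ s with hv
  have hvP : ∀ s, v s = ((s ^ 2 * Ω2 s : ℝ) : ℂ) * deriv ψ s := by
    intro s; rw [hv]; push_cast; rfl
  set v' : ℝ → ℂ := fun r => (((c * α : ℝ) : ℂ) - ω ^ 2 / ((Ω2 r : ℝ) : ℂ)) * (r : ℂ) ^ 2 * ψ r with hv'
  have hvd : ∀ r ∈ Ioi rp, HasDerivAt v (v' r) r := by
    intro r hr
    have hr0 : 0 < r := hrp.trans hr
    have : DifferentiableAt ℝ v r := by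
      have h1 := ((hPd r hr0).ofReal_comp.differentiableAt).mul (hψ2 r hr)
      refine h1.congr_of_eventuallyEq ?_
      filter_upwards with s using hvP s
    have h2 := this.hasDerivAt
    rwa [hode r hr] at h2
  -- horizon
  have hv0 : Tendsto v (𝓝[>] rp) (𝓝 0) := by
    have hΩd : HasDerivAt Ω2 (deriv Ω2 rp) rp := (differentiableAt_of_deriv_ne_zero hT.ne').hasDerivAt
    have hs := (hasDerivAt_iff_tendsto_slope.1 hΩd).eventually (lt_mem_nhds (half_lt_self hT))
    have hs' : ∀ᶠ x in 𝓝[>] rp, deriv Ω2 rp / 2 < slope Ω2 rp x :=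
      hs.filter_mono (nhdsWithin_mono rp (fun x hx => ne_of_gt (mem_Ioi.1 hx)))
    rw [Filter.Eventually, mem_nhdsGT_iff_exists_Ioo_subset] at hs'
    obtain ⟨b, hb, hsub⟩ := hs'
    have hb' : rp < b := hb
    set κ := deriv Ω2 rp / 2 with hκ
    have hκ0 : 0 < κ := by rw [hκ]; linarith
    obtain ⟨B1, hB1⟩ := (isCompact_Icc (a := rp) (b := rp + 1)).exists_bound_of_continuousOn
      (f := fun s : ℝ => 4 * c * s ^ 3 + 2 * s - 2 * M) (by fun_prop)
    have hB1n : 0 ≤ B1 := (norm_nonneg _).trans (hB1 rp ⟨le_rfl, by linarith⟩)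
    set B2 := (|c * α| + ‖ω‖ ^ 2 / κ) * (rp + 1) ^ 2 with hB2
    have hB2n : 0 ≤ B2 := by positivity
    set δ := min (b - rp) 1 with hδ
    have hδb : δ ≤ b - rp := min_le_left _ _
    have hδ1 : δ ≤ 1 := min_le_right _ _
    refine aux_horizon rp (B1 + B2 + 1) δ (lt_min (by linarith) one_pos) (by positivity)
      (fun s => s ^ 2 * Ω2 s) (fun s => 4 * c * s ^ 3 + 2 * s - 2 * M) ψ (deriv ψ) v v'
      (fun s hs => hPd s (hrp.trans hs.1)) (fun s hs => hψ1 s hs.1) (fun s hs => hvd s hs.1)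
      (fun s hs => hvP s) ?_ ?_ ?_ hhor
    · intro s hs
      have := hB1 s ⟨hs.1.le, by linarith [hs.2]⟩
      rw [Real.norm_eq_abs] at this
      linarith
    · intro s hs
      have := (convex_Icc rp (rp + 1)).norm_image_sub_le_of_norm_hasDerivWithin_le
        (f := fun s => s ^ 2 * Ω2 s) (f' := fun s : ℝ => 4 * c * s ^ 3 + 2 * s - 2 * M) (C := B1)
        (fun x hx => (hPd x (by linarith [hx.1])).hasDerivWithinAt) hB1
        (x := rp) (y := s) ⟨le_rfl, by linarith⟩ ⟨hs.1.le, by linarith [hs.2]⟩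
      simp only [hroot, mul_zero, sub_zero, Real.norm_eq_abs] at this
      rw [abs_of_pos (by linarith [hs.1] : 0 < s - rp)] at this
      refine this.trans ?_
      have : 0 ≤ s - rp := by linarith [hs.1]
      gcongr
      linarith
    · intro s hs
      have hsp : 0 < s - rp := by linarith [hs.1]
      have hs1 : s - rp ≤ 1 := by linarith [hs.2]
      have hΩl : κ * (s - rp) ≤ Ω2 s := by
        have h1 : κ < slope Ω2 rp s := hsub ⟨hs.1, by linarith [hs.2]⟩
        rw [slope_def_field, hroot, sub_zero, lt_div_iff₀ hsp] at h1
        exact h1.le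
      have hΩp := hpos s hs.1
      have n1 : ‖((c * α : ℝ) : ℂ) - ω ^ 2 / ((Ω2 s : ℝ) : ℂ)‖ ≤ (|c * α| + ‖ω‖ ^ 2 / κ) / (s - rp) := by
        refine (norm_sub_le _ _).trans ?_
        rw [Complex.norm_real, norm_div, norm_pow, Complex.norm_real, Real.norm_eq_abs,
          Real.norm_eq_abs, abs_of_pos hΩp, add_div]
        apply add_le_add
        · rw [le_div_iff₀ hsp]; exact mul_le_of_le_one_right (abs_nonneg _) hs1
        · rw [div_div]; gcongr
      rw [hv']
      simp only
      rw [norm_mul, norm_mul, norm_pow, Complex.norm_real, Real.norm_eq_abs, abs_of_pos (hrp.trans hs.1)]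
      have hs2 : s ≤ rp + 1 := by linarith
      have hs0 : 0 < s := hrp.trans hs.1
      calc _ ≤ (|c * α| + ‖ω‖ ^ 2 / κ) / (s - rp) * (rp + 1) ^ 2 * ‖ψ s‖ := by gcongr
        _ = B2 / (s - rp) * ‖ψ s‖ := by rw [hB2]; ring
        _ ≤ _ := by gcongr; linarith
  -- infinity
  set a := (3 : ℝ) / 2 - Δ with ha
  have haα : α + 3 * a - a ^ 2 = 0 := by rw [ha]; nlinarith
  have hgr := aux_growth M e c hc Ω2 hΩ2
  set u : ℝ → ℂ := fun s => ((s ^ a : ℝ) : ℂ) * ψ s with hu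
  set u' : ℝ → ℂ := fun s => ((a * s ^ (a - 1) : ℝ) : ℂ) * ψ s + ((s ^ a : ℝ) : ℂ) * deriv ψ s with hu'
  have hud : ∀ r ∈ Ioi rp, HasDerivAt u (u' r) r := by
    intro r hr
    have hr0 : r ≠ 0 := (hrp.trans hr).ne'
    exact ((Real.hasDerivAt_rpow_const (p := a) (Or.inl hr0)).ofReal_comp).mul (hψ1 r hr)
  set w : ℝ → ℂ := fun s => ((s ^ (-a) : ℝ) : ℂ) * v s
    + ((a * (s ^ 2 * Ω2 s) * s ^ (-a - 1) : ℝ) : ℂ) * ψ s with hw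
  set K : ℝ → ℂ := fun r => -ω ^ 2 * ((Ω2 r / r ^ 2)⁻¹ : ℝ)
    + ((a * (2 - 2 * M * r⁻¹) - a * (a + 1) * (1 - 2 * M * r⁻¹ + e ^ 2 * (r⁻¹) ^ 2) : ℝ) : ℂ) with hK
  set w' : ℝ → ℂ := fun r => ((r ^ (-a) : ℝ) : ℂ) ^ 2 * K r * u r with hw'
  have hwd : ∀ r ∈ Ioi rp, HasDerivAt w (w' r) r := by
    intro r hr
    have hr0 : 0 < r := hrp.trans hr
    have hΩp := hpos r hr
    have d1 := ((Real.hasDerivAt_rpow_const (x := r) (p := -a) (Or.inl hr0.ne')).ofReal_comp).mul (hvd r hr)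
    have d2 := ((((hPd r hr0).const_mul a).mul
      (Real.hasDerivAt_rpow_const (x := r) (p := -a - 1) (Or.inl hr0.ne'))).ofReal_comp).mul (hψ1 r hr)
    refine (d1.add d2).congr_deriv ?_
    have hX : 0 < r ^ a := Real.rpow_pos_of_pos hr0 a
    have e0 : r ^ (-a) = (r ^ a)⁻¹ := Real.rpow_neg hr0.le a
    have e1 : r ^ (-a - 1) = (r ^ a)⁻¹ / r := by rw [Real.rpow_sub_one hr0.ne', e0]
    have e2 : r ^ (-a - 1 - 1) = (r ^ a)⁻¹ / r / r := by rw [Real.rpow_sub_one hr0.ne', e1]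
    simp only [hw', hK, hu, hv', hvP, Pi.mul_apply]
    rw [e2, e1, e0]
    generalize r ^ a = X at hX
    have hXc : (X : ℂ) ≠ 0 := by exact_mod_cast hX.ne'
    have hrc : (r : ℂ) ≠ 0 := by exact_mod_cast hr0.ne'
    have hΩc : (Ω2 r : ℂ) ≠ 0 := by exact_mod_cast hΩp.ne'
    have hPc : (r : ℂ) ^ 2 * (Ω2 r : ℂ) = c * r ^ 4 + r ^ 2 - 2 * M * r + e ^ 2 := by
      exact_mod_cast hP0 r hr0
    have hac : (α : ℂ) = a ^ 2 - 3 * a := by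
      have : α = a ^ 2 - 3 * a := by linarith
      rw [this]; push_cast; ring
    push_cast
    generalize deriv ψ r = p
    generalize ψ r = q
    rw [hac]
    generalize (Ω2 r : ℂ) = O at *
    have hO : ∀ z : ℂ, z * ((r : ℂ) ^ 2 * O) = z * (c * r ^ 4 + r ^ 2 - 2 * M * r + e ^ 2) := fun z => by rw [hPc]
    have step : ∀ z : ℂ, (c * (a ^ 2 - 3 * a) - z / O) * r ^ 2 + a * (4 * c * r ^ 3 + 2 * r - 2 * M) / r
        - a * (a + 1) * (r ^ 2 * O) / r ^ 2
        = -z * (O / r ^ 2)⁻¹ + (a * (2 - 2 * M * (r:ℂ)⁻¹) - a * (a + 1) * (1 - 2 * M * (r:ℂ)⁻¹ + e ^ 2 * ((r:ℂ)⁻¹) ^ 2)) := by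
      intro z; rw [hPc]; field_simp; ring
    rw [← step]
    field_simp
    ring
  have huw : ∀ r ∈ Ioi rp, w r = ((Ω2 r / r ^ 2 * r ^ (2 * Δ + 1) : ℝ) : ℂ) * u' r := by
    intro r hr
    have hr0 : 0 < r := hrp.trans hr
    have hX : 0 < r ^ a := Real.rpow_pos_of_pos hr0 a
    have e0 : r ^ (-a) = (r ^ a)⁻¹ := Real.rpow_neg hr0.le a
    have e1 : r ^ (-a - 1) = (r ^ a)⁻¹ / r := by rw [Real.rpow_sub_one hr0.ne', e0]
    have e2 : r ^ (a - 1) = (r ^ a) / r := by rw [Real.rpow_sub_one hr0.ne']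
    have e3 : r ^ (2 * Δ + 1) = r ^ 4 * ((r ^ a)⁻¹) ^ 2 := by
      rw [← e0, ← Real.rpow_natCast, ← Real.rpow_natCast, ← Real.rpow_mul hr0.le, ← Real.rpow_add hr0]
      congr 1; rw [ha]; push_cast; ring
    simp only [hw, hu', hvP]
    rw [e3, e1, e0, e2]
    have hXc : ((r ^ a : ℝ) : ℂ) ≠ 0 := by exact_mod_cast hX.ne'
    have hrc : (r : ℂ) ≠ 0 := by exact_mod_cast hr0.ne'
    push_cast
    field_simp
    ring
  have hFu : ∀ r ∈ Ioi rp, (starRingEnd ℂ (ψ r) * v r).im = (starRingEnd ℂ (u r) * w r).im := by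
    intro r hr
    have hr0 : 0 < r := hrp.trans hr
    have hX : 0 < r ^ a := Real.rpow_pos_of_pos hr0 a
    have e0 : r ^ (-a) = (r ^ a)⁻¹ := Real.rpow_neg hr0.le a
    have hXc : ((r ^ a : ℝ) : ℂ) ≠ 0 := by exact_mod_cast hX.ne'
    have : starRingEnd ℂ (u r) * w r = starRingEnd ℂ (ψ r) * v r +
        ((r ^ a * (a * (r ^ 2 * Ω2 r) * r ^ (-a - 1)) * Complex.normSq (ψ r) : ℝ) : ℂ) := by
      simp only [hu, hw, map_mul, Complex.conj_ofReal]
      rw [Complex.ofReal_mul _ (Complex.normSq (ψ r)), Complex.normSq_eq_conj_mul_self, e0]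
      push_cast
      field_simp
    rw [this, Complex.add_im, Complex.ofReal_im, add_zero]
  have hev : ∃ R, 1 ≤ R ∧ rp < R ∧ ∀ r ≥ R, c / 2 ≤ Ω2 r / r ^ 2 := by
    obtain ⟨R, hR⟩ := eventually_atTop.1 (hgr.eventually (lt_mem_nhds (half_lt_self hc)))
    exact ⟨max R (max 1 (rp + 1)), by simp, by
      have := (le_max_right 1 (rp + 1)).trans (le_max_right R _); linarith,
      fun r hr => (hR r ((le_max_left _ _).trans hr)).le⟩
  have hFinf : Tendsto (fun r => (starRingEnd ℂ (ψ r) * v r).im) atTop (𝓝 0) := by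
    obtain ⟨R, hR1, hRrp, hRΩ⟩ := hev
    suffices h : Tendsto (fun r => ‖u r‖ * ‖w r‖) atTop (𝓝 0) by
      refine squeeze_zero_norm' ?_ h
      filter_upwards [eventually_gt_atTop rp] with r hr
      rw [hFu r hr, Real.norm_eq_abs]
      refine (Complex.abs_im_le_norm _).trans ?_
      rw [norm_mul, RCLike.norm_conj]
    rcases hbc with hD | hN
    · have hu0 : Tendsto u atTop (𝓝 0) := hD.congr (fun r => by simp [hu])
      have hKb : ∃ B, ∀ᶠ r in atTop, ‖K r‖ ≤ B := by
        have hi : Tendsto (fun r : ℝ => r⁻¹) atTop (𝓝 0) := tendsto_inv_atTop_zero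
        have t1 := ((hgr.inv₀ hc.ne').ofReal).const_mul (-ω ^ 2)
        have t2 : Tendsto (fun r : ℝ => a * (2 - 2 * M * r⁻¹) - a * (a + 1) * (1 - 2 * M * r⁻¹ + e ^ 2 * (r⁻¹) ^ 2)) atTop
          (𝓝 (a * (2 - 2 * M * 0) - a * (a + 1) * (1 - 2 * M * 0 + e ^ 2 * 0 ^ 2))) :=
          ((hi.const_mul _).const_sub 2 |>.const_mul a).sub
            ((((hi.const_mul _).const_sub 1).add ((hi.pow 2).const_mul _)).const_mul _)
        have t3 := (t1.add (t2.ofReal)).norm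
        exact ⟨_, (t3.eventually (gt_mem_nhds (lt_add_one _))).mono fun r hr => hr.le⟩
      obtain ⟨B, hB⟩ := hKb
      obtain ⟨R2, hR2⟩ := eventually_atTop.1 hB
      have hbig : ∀ r ≥ max R R2, rp < r ∧ 1 ≤ r ∧ R ≤ r ∧ ‖K r‖ ≤ B := fun r hr =>
        have h1 := (le_max_left R R2).trans hr
        have h2 := (le_max_right R R2).trans hr
        ⟨by linarith, by linarith, h1, hR2 r h2⟩
      obtain ⟨W, hW⟩ := aux_infty Δ (max R R2) (2 / c + |B|) hΔ0 hΔ2 (hR1.trans (le_max_left _ _))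
        (by positivity) u u' w w' (fun r hr => hud r (hbig r hr).1) (fun r hr => hwd r (hbig r hr).1)
        (fun r hr => by
          obtain ⟨h1, h2, h3, h4⟩ := hbig r hr
          have hq := hRΩ r h3
          have hr0 : 0 < r := by linarith
          have hY : 0 < r ^ (2 * Δ + 1) := Real.rpow_pos_of_pos hr0 _
          have e1 : r ^ (-2 * Δ - 1) = (r ^ (2 * Δ + 1))⁻¹ := by
            rw [← Real.rpow_neg hr0.le]; congr 1; ring
          have hq0 : 0 < Ω2 r / r ^ 2 := by linarith [half_pos hc]
          rw [huw r h1, norm_mul, Complex.norm_real, Real.norm_eq_abs, abs_of_pos (mul_pos hq0 hY), e1]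
          have e2 : (2 / c + |B|) * (r ^ (2 * Δ + 1))⁻¹ * (Ω2 r / r ^ 2 * r ^ (2 * Δ + 1) * ‖u' r‖)
            = ((2 / c + |B|) * (Ω2 r / r ^ 2)) * ‖u' r‖ := by
            generalize Ω2 r / r ^ 2 = Q
            field_simp
          rw [e2]
          refine le_mul_of_one_le_left (norm_nonneg _) ?_
          calc (1:ℝ) = 2 / c * (c / 2) := by field_simp
            _ ≤ _ := by
              gcongr
              linarith [abs_nonneg B])
        (fun r hr => by
          obtain ⟨h1, h2, h3, h4⟩ := hbig r hr
          have hr0 : 0 < r := by linarith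
          have e1 : r ^ (2 * Δ - 3) = (r ^ (-a)) ^ 2 := by
            rw [← Real.rpow_natCast, ← Real.rpow_mul hr0.le]; congr 1; rw [ha]; push_cast; ring
          simp only [hw']
          rw [norm_mul, norm_mul, norm_pow, Complex.norm_real, Real.norm_eq_abs, sq_abs, e1, mul_comm _ ‖K r‖]
          have : ‖K r‖ ≤ 2 / c + |B| := by
            have := le_abs_self B
            have : 0 < 2 / c := by positivity
            linarith
          gcongr) hu0
      refine squeeze_zero' (g := fun r => ‖u r‖ * W) (Eventually.of_forall fun r => by positivity) ?_ ?_
      · filter_upwards [hW] with r hr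
        gcongr
      · simpa using hu0.norm.mul_const W
    · have hN' : Tendsto (fun r : ℝ => ((r ^ (2 * Δ + 1) : ℝ) : ℂ) * u' r) atTop (𝓝 0) := by
        refine hN.congr' ?_
        filter_upwards [eventually_gt_atTop rp] with r hr
        have e1 : (fun s : ℝ => (s ^ a : ℝ) • ψ s) = u := by funext s; simp [hu]
        rw [e1, (hud r hr).deriv, Complex.real_smul]
      have hw0 : Tendsto w atTop (𝓝 0) := by
        have := (hgr.ofReal).mul hN'
        rw [mul_zero] at this
        refine this.congr' ?_
        filter_upwards [eventually_gt_atTop rp] with r hr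
        rw [huw r hr, ← mul_assoc]
        simp
      have hub : ∃ U, ∀ᶠ r in atTop, ‖u r‖ ≤ U := by
        have h1 : ∀ᶠ r in atTop, ‖((r ^ (2 * Δ + 1) : ℝ) : ℂ) * u' r‖ < 1 := by
          have := (Metric.tendsto_nhds.1 hN') 1 one_pos
          simpa only [dist_zero_right] using this
        obtain ⟨R3, hR3⟩ := eventually_atTop.1 h1
        set S := max R R3
        have hSR : R ≤ S := le_max_left _ _
        refine ⟨‖u S‖ + 1 / (2 * Δ) * S ^ (-(2 * Δ)), eventually_atTop.2 ⟨S, fun r hr => ?_⟩⟩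
        have := aux_int S 1 (2 * Δ) (by linarith) (by linarith) zero_le_one u u'
          (fun r hr => hud r (lt_of_lt_of_le hRrp (hSR.trans hr)))
          (fun r hr => by
            have h3 := (hR3 r ((le_max_right _ _).trans hr)).le
            have hr0 : 0 < r := by have : S ≤ r := hr; linarith
            have hY : 0 < r ^ (2 * Δ + 1) := Real.rpow_pos_of_pos hr0 _
            rw [norm_mul, Complex.norm_real, Real.norm_eq_abs, abs_of_pos hY] at h3
            have e1 : r ^ (-(2 * Δ) - 1) = (r ^ (2 * Δ + 1))⁻¹ := by
              rw [← Real.rpow_neg hr0.le]; congr 1; ring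
            rw [e1, one_mul, ← one_div, le_div_iff₀ hY, mul_comm]
            exact h3) S r le_rfl hr
        have := norm_le_norm_add_norm_sub' (u r) (u S)
        linarith
      obtain ⟨U, hU⟩ := hub
      refine squeeze_zero' (g := fun r => U * ‖w r‖) (Eventually.of_forall fun r => by positivity) ?_ ?_
      · filter_upwards [hU] with r hr
        gcongr
      · simpa using hw0.norm.const_mul U
  have hF0 : Tendsto (fun r => (starRingEnd ℂ (ψ r) * v r).im) (𝓝[>] rp) (𝓝 0) := by
    have h1 : Tendsto (fun r => ‖ψ r‖ * ‖v r‖) (𝓝[>] rp) (𝓝 0) := by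
      simpa using hhor.norm.mul hv0.norm
    refine squeeze_zero_norm (fun r => ?_) h1
    rw [Real.norm_eq_abs]
    refine (Complex.abs_im_le_norm _).trans ?_
    rw [norm_mul, RCLike.norm_conj]
  by_contra hre
  obtain ⟨r, hr, hne⟩ := hnt
  have hz := aux_mono rp (-2 * ω.re * ω.im) (by simp [hre, hω.ne])
    (fun r => (starRingEnd ℂ (ψ r) * v r).im) (fun r => r ^ 2 * Complex.normSq (ψ r) / Ω2 r)
    (fun r hr => div_nonneg (mul_nonneg (sq_nonneg _) (Complex.normSq_nonneg _)) (hpos r hr).le)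
    (fun r hr => by
      have d1 : HasDerivAt (fun s => starRingEnd ℂ (ψ s)) (starRingEnd ℂ (deriv ψ r)) r := (hψ1 r hr).star
      have d2 := d1.mul (hvd r hr)
      have d3 := Complex.imCLM.hasFDerivAt.comp_hasDerivAt r d2
      refine d3.congr_deriv ?_
      have hΩp := hpos r hr
      have t1 : starRingEnd ℂ (deriv ψ r) * v r = ((r ^ 2 * Ω2 r * Complex.normSq (deriv ψ r) : ℝ) : ℂ) := by
        rw [hvP, Complex.ofReal_mul _ (Complex.normSq _), Complex.normSq_eq_conj_mul_self]; ring
      have t2 : starRingEnd ℂ (ψ r) * v' r =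
          ((c * α * r ^ 2 * Complex.normSq (ψ r) : ℝ) : ℂ)
            - ω ^ 2 * ((r ^ 2 * Complex.normSq (ψ r) / Ω2 r : ℝ) : ℂ) := by
        simp only [hv']
        push_cast
        rw [Complex.normSq_eq_conj_mul_self]; ring
      rw [Complex.imCLM_apply, t1, t2, Complex.add_im, Complex.sub_im, Complex.ofReal_im,
        Complex.ofReal_im, Complex.im_mul_ofReal, pow_two, Complex.mul_im]
      ring) hF0 hFinf r hr
  have hr0 : r ≠ 0 := (hrp.trans hr).ne'
  have := (hpos r hr).ne'
  simp_all
end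

section
/- Let (r₊, Λ, α, q₀) satisfy -9/4 < α < min{0, -3/2 + q₀²/(2(-Λ/3))} and (-Λ/3)r₊² > R₀, where R₀ is the positive root of 24(α + 3/2 - q₀²/(2(-Λ/3)))x² + (4(α + 3/2 - q₀²/(2(-Λ/3))) - 2q₀²/(-Λ/3) + 6)x + 1 = 0. Then for M = M₀ := r₊(1 + 2(-Λ/3)r₊²) (the extremal mass), the energy functional L_{M₀}[f] = ∫_{r₊}^∞ r²Ω_{M₀}²(f')² + ((-Λ/3)α - q₀²A²/Ω_{M₀}²) r² f² dr admits a negative energy bound state: there exists f ∈ C_c^∞(r₊, ∞) with L_{M₀}[f] < 0. -/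
open MeasureTheory Set

lemma aux_bump (K V T : ℝ) (hK : 0 < K) (hKV : K / 4 < V) :
    ∃ g : ℝ → ℝ, ∃ a : ℝ, ContDiff ℝ (⊤ : ℕ∞) g ∧ HasCompactSupport g ∧
      tsupport g ⊆ Icc a T ∧
      (∫ y, (K * (deriv g y - g y / 2) ^ 2 - V * (g y) ^ 2)) < 0 := by
  let φ : ContDiffBump (0 : ℝ) := ⟨1, 2, by norm_num, by norm_num⟩
  have hφc : ContDiff ℝ (⊤ : ℕ∞) (φ : ℝ → ℝ) := φ.contDiff
  have hφd : Differentiable ℝ (φ : ℝ → ℝ) := hφc.differentiable (by simp)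
  have hφs : HasCompactSupport (φ : ℝ → ℝ) := φ.hasCompactSupport
  have hdc : Continuous (deriv (φ : ℝ → ℝ)) := hφc.continuous_deriv (by simp)
  have hds : HasCompactSupport (deriv (φ : ℝ → ℝ)) := hφs.deriv
  have i1 : Integrable (fun u => (deriv φ u) ^ 2) := by
    refine Continuous.integrable_of_hasCompactSupport (by fun_prop) ?_
    exact hds.comp_left (g := fun x : ℝ => x ^ 2) (by simp)
  have i2 : Integrable (fun u => (φ u) ^ 2) := by
    refine Continuous.integrable_of_hasCompactSupport (hφc.continuous.pow 2) ?_
    exact hφs.comp_left (g := fun x : ℝ => x ^ 2) (by simp)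
  have i3 : Integrable (fun u => φ u * deriv φ u) := by
    refine Continuous.integrable_of_hasCompactSupport (hφc.continuous.mul hdc) ?_
    exact hφs.mul_right
  have z3 : ∫ u, φ u * deriv φ u = 0 := by
    refine integral_eq_zero_of_hasDerivAt_of_integrable (f := fun u => (φ u) ^ 2 / 2) ?_ i3 ?_
    · intro u
      have := ((hφd u).hasDerivAt.pow 2).div_const 2
      exact this.congr_deriv (by push_cast; ring)
    · exact i2.div_const 2
  have hB : 0 < ∫ u, (φ u) ^ 2 := by
    rw [integral_pos_iff_support_of_nonneg (fun u => sq_nonneg _) i2]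
    have : Function.support (fun u => (φ u) ^ 2) = Metric.ball 0 2 := by
      ext u
      have := φ.support_eq
      simp only [Function.mem_support, ne_eq, pow_eq_zero_iff, OfNat.ofNat_ne_zero, not_false_eq_true]
      rw [← ne_eq, ← Function.mem_support, this]
    rw [this]
    exact Metric.measure_ball_pos _ _ (by norm_num)
  set A := ∫ u, (deriv φ u) ^ 2 with hA
  set B := ∫ u, (φ u) ^ 2 with hBdef
  have hA0 : 0 ≤ A := integral_nonneg (fun u => sq_nonneg _)
  have hD : 0 < (V - K / 4) * B := mul_pos (by linarith) hB
  obtain ⟨N, hN1, hN⟩ : ∃ N : ℝ, 1 ≤ N ∧ K * A < N * ((V - K / 4) * B) := by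
    refine ⟨1 + K * A / ((V - K / 4) * B), ?_, ?_⟩
    · have : 0 ≤ K * A / ((V - K / 4) * B) := by positivity
      linarith
    · rw [add_mul, div_mul_cancel₀ _ hD.ne']; linarith
  have hN0 : 0 < N := by linarith
  let g : ℝ → ℝ := fun y => φ ((y + (2 * N - T)) / N)
  have hgsub : tsupport g ⊆ Icc (T - 4 * N) T := by
    refine closure_minimal ?_ isClosed_Icc
    intro y hy
    have h1 : (y + (2 * N - T)) / N ∈ Function.support φ := hy
    rw [φ.support_eq, Metric.mem_ball, dist_zero_right, Real.norm_eq_abs, abs_lt] at h1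
    have e : φ.rOut = 2 := rfl
    rw [e, lt_div_iff₀ hN0, div_lt_iff₀ hN0] at h1
    constructor <;> linarith [h1.1, h1.2]
  refine ⟨g, T - 4 * N, ?_, ?_, hgsub, ?_⟩
  · exact hφc.comp (by fun_prop)
  · exact HasCompactSupport.of_support_subset_isCompact isCompact_Icc
      ((subset_tsupport g).trans hgsub)
  · have hdg : ∀ y, deriv g y = deriv φ ((y + (2 * N - T)) / N) / N := by
      intro y
      have h1 : HasDerivAt (fun y : ℝ => (y + (2 * N - T)) / N) (1 / N) y :=
        ((hasDerivAt_id y).add_const _).div_const N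
      have := ((hφd ((y + (2 * N - T)) / N)).hasDerivAt).comp y h1
      have h2 := this.deriv
      change deriv g y = _ at h2
      rw [h2]; ring
    let F : ℝ → ℝ := fun u => K * (deriv φ u / N - φ u / 2) ^ 2 - V * (φ u) ^ 2
    have e1 : (∫ y, (K * (deriv g y - g y / 2) ^ 2 - V * (g y) ^ 2)) =
        ∫ y, F ((y + (2 * N - T)) / N) := by
      congr 1; ext y; simp only [hdg, F, g]
    have e2 : ∫ y, F ((y + (2 * N - T)) / N) = N * ∫ u, F u := by
      rw [integral_add_right_eq_self (fun y => F (y / N)), Measure.integral_comp_div,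
        abs_of_pos hN0, smul_eq_mul]
    have e3 : ∫ u, F u = K / N ^ 2 * A - K / N * 0 + (K / 4 - V) * B := by
      rw [← z3, hA, hBdef, ← integral_const_mul, ← integral_const_mul, ← integral_const_mul,
        ← integral_sub (i1.const_mul _) (i3.const_mul _)]
      refine Eq.trans ?_ (integral_add ((i1.const_mul _).sub (i3.const_mul _)) (i2.const_mul _))
      congr 1; ext u; simp only [F, Pi.sub_apply]; field_simp; ring
    rw [e1, e2, e3]
    refine mul_neg_of_pos_of_neg hN0 ?_
    have h5 : K / N ^ 2 * A ≤ K * A / N := by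
      rw [div_mul_eq_mul_div]
      refine div_le_div_of_nonneg_left (by positivity) hN0 ?_
      nlinarith
    have h6 : K * A / N < (V - K / 4) * B := by
      rw [div_lt_iff₀ hN0]; linarith
    linarith

lemma aux_f (rp a b : ℝ) (g : ℝ → ℝ) (hg : ContDiff ℝ (⊤ : ℕ∞) g) (hs : tsupport g ⊆ Icc a b) :
    ∃ f : ℝ → ℝ, ContDiff ℝ (⊤ : ℕ∞) f ∧ HasCompactSupport f ∧ tsupport f ⊆ Ioi rp ∧
      ∀ y, f (rp + Real.exp y) = Real.exp (-y / 2) * g y ∧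
        deriv f (rp + Real.exp y) = Real.exp (-y / 2) / Real.exp y * (deriv g y - g y / 2) := by
  classical
  let h : ℝ → ℝ := fun r => Real.exp (-Real.log (r - rp) / 2) * g (Real.log (r - rp))
  let f : ℝ → ℝ := fun r => if rp < r then h r else 0
  have hsupp : Function.support f ⊆ Icc (rp + Real.exp a) (rp + Real.exp b) := by
    intro r hr
    simp only [Function.mem_support, f] at hr
    split_ifs at hr with h1
    · have h2 : g (Real.log (r - rp)) ≠ 0 := fun h0 => hr (by simp [h, h0])
      have h3 := hs (subset_tsupport g h2)
      have hpos : 0 < r - rp := by linarith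
      have h4 := (Real.le_log_iff_exp_le hpos).1 h3.1
      have h5 := (Real.log_le_iff_le_exp hpos).1 h3.2
      constructor <;> linarith
    · exact absurd rfl hr
  have hts : tsupport f ⊆ Icc (rp + Real.exp a) (rp + Real.exp b) :=
    closure_minimal hsupp isClosed_Icc
  have hev : ∀ r, rp < r → f =ᶠ[nhds r] h := by
    intro r hr
    filter_upwards [Ioi_mem_nhds hr] with x hx
    exact if_pos (mem_Ioi.1 hx)
  refine ⟨f, ?_, ?_, ?_, ?_⟩
  · rw [contDiff_iff_contDiffAt]
    intro r
    by_cases hr : rp < r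
    · refine ContDiffAt.congr_of_eventuallyEq ?_ (hev r hr)
      have hl : ContDiffAt ℝ (⊤ : ℕ∞) (fun r => Real.log (r - rp)) r :=
        (contDiffAt_id.sub contDiffAt_const).log (by simp; linarith)
      exact ((hl.neg.div_const 2).exp).mul (hg.contDiffAt.comp r hl)
    · refine ContDiffAt.congr_of_eventuallyEq (f := fun _ => (0 : ℝ)) contDiffAt_const ?_
      have : r < rp + Real.exp a := by linarith [Real.exp_pos a]
      filter_upwards [Iio_mem_nhds this] with x hx
      by_contra h0
      have := (hsupp h0).1
      exact absurd hx (not_lt.2 this)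
  · exact HasCompactSupport.of_support_subset_isCompact isCompact_Icc hsupp
  · intro r hr
    have := (hts hr).1
    simp only [mem_Ioi]; linarith [Real.exp_pos a]
  · intro y
    have hy : rp < rp + Real.exp y := by linarith [Real.exp_pos y]
    refine ⟨?_, ?_⟩
    · simp only [f]; rw [if_pos hy]; simp [h]
    · rw [(hev _ hy).deriv_eq]
      have h1 : HasDerivAt (fun r => Real.log (r - rp)) (1 / Real.exp y) (rp + Real.exp y) := by
        have := ((hasDerivAt_id (rp + Real.exp y)).sub_const rp).log
          (by simp [Real.exp_ne_zero])
        simpa using this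
      have h2 := (h1.neg.div_const 2).exp
      have hgd : HasDerivAt g (deriv g y) (Real.log (rp + Real.exp y - rp)) := by
        have := (hg.differentiable (by simp) y).hasDerivAt
        simpa using this
      have h3 := HasDerivAt.comp (h := fun r => Real.log (r - rp)) (rp + Real.exp y) hgd h1
      have h4 := (h2.mul h3).deriv
      refine Eq.trans ?_ (h4.trans ?_)
      · rfl
      · simp
        field_simp
        ring

lemma aux_cov (rp : ℝ) (G : ℝ → ℝ) :
    ∫ r in Ioi rp, G r = ∫ y, Real.exp y * G (rp + Real.exp y) := by
  have him : (fun y => rp + Real.exp y) '' univ = Ioi rp := by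
    ext r
    simp only [image_univ, mem_range, mem_Ioi]
    constructor
    · rintro ⟨y, rfl⟩; linarith [Real.exp_pos y]
    · intro hr; exact ⟨Real.log (r - rp), by rw [Real.exp_log (by linarith)]; ring⟩
  have := integral_image_eq_integral_abs_deriv_smul (s := univ) (f := fun y => rp + Real.exp y)
    (f' := fun y => Real.exp y) MeasurableSet.univ
    (fun x _ => ((Real.hasDerivAt_exp x).const_add rp).hasDerivWithinAt)
    (fun x _ y _ hxy => Real.exp_injective (by simpa using hxy)) G
  rw [him] at this
  rw [this]
  simp

/-- Negative energy bound state at the extremal mass `M₀`: under the conditions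
`-9/4 < α < min{0, -3/2 + q₀²/(2(-Λ/3))}` and `(-Λ/3)r₊² > R₀` (with `R₀` the
positive root of the quadratic \eqref{quadratic}), there is a smooth compactly
supported `f` with `L_{M₀}[f] < 0`. -/
theorem extremal_negative_energy_bound_state (rp Λ α q0 R0 : ℝ)
    (hrp : 0 < rp) (hΛ : Λ < 0)
    (hα1 : -9 / 4 < α)
    (hα2 : α < min 0 (-3 / 2 + q0 ^ 2 / (2 * (-Λ / 3))))
    (hR0pos : 0 < R0)
    (hR0 : 24 * (α + 3 / 2 - q0 ^ 2 / (2 * (-Λ / 3))) * R0 ^ 2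
        + (4 * (α + 3 / 2 - q0 ^ 2 / (2 * (-Λ / 3))) - 2 * q0 ^ 2 / (-Λ / 3) + 6) * R0
        + 1 = 0)
    (hlarge : (-Λ / 3) * rp ^ 2 > R0)
    (M0 e02 : ℝ) (hM0 : M0 = rp * (1 + 2 * (-Λ / 3) * rp ^ 2))
    (he02 : e02 = rp ^ 2 * (1 + 3 * (-Λ / 3) * rp ^ 2))
    (Ω2 : ℝ → ℝ)
    (hΩ2 : ∀ r : ℝ, Ω2 r = 1 - 2 * M0 / r + e02 / r ^ 2 + (-Λ / 3) * r ^ 2) :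
    ∃ f : ℝ → ℝ, ContDiff ℝ (⊤ : ℕ∞) f ∧ HasCompactSupport f ∧ tsupport f ⊆ Set.Ioi rp ∧
      (∫ r in Set.Ioi rp,
        (r ^ 2 * Ω2 r * (deriv f r) ^ 2
          + ((-Λ / 3) * α - q0 ^ 2 * e02 * (1 / rp - 1 / r) ^ 2 / Ω2 r)
              * r ^ 2 * (f r) ^ 2)) < 0 := by
  have hl : 0 < -Λ / 3 := by linarith
  generalize -Λ / 3 = l at *
  have hα3 : α < -3 / 2 + q0 ^ 2 / (2 * l) := lt_of_lt_of_le hα2 (min_le_right _ _)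
  set P : ℝ → ℝ := fun r => l * (r ^ 2 + 2 * rp * r + 3 * rp ^ 2) + 1 with hP
  set W : ℝ → ℝ := fun r => l * α * r ^ 2 - q0 ^ 2 * (1 + 3 * l * rp ^ 2) * r ^ 2 / P r with hW
  have hPpos : ∀ r, rp ≤ r → 0 < P r := by
    intro r hr
    have : 0 < r := by linarith
    simp only [hP]; positivity
  have hPc : Continuous P := by simp only [hP]; fun_prop
  have hOm : ∀ r, rp < r → r ^ 2 * Ω2 r = (r - rp) ^ 2 * P r := by
    intro r hr
    have : r ≠ 0 := by linarith
    rw [hΩ2, hM0, he02]; simp only [hP]; field_simp; ring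
  have hWe : ∀ r, rp < r → (l * α - q0 ^ 2 * e02 * (1 / rp - 1 / r) ^ 2 / Ω2 r) * r ^ 2 = W r := by
    intro r hr
    have h0 : r ≠ 0 := by linarith
    have h1 : r - rp ≠ 0 := by linarith
    have h2 := (hPpos r hr.le).ne'
    have h3 : Ω2 r = (r - rp) ^ 2 * P r / r ^ 2 := by
      rw [← hOm r hr]; field_simp
    rw [h3, he02]; simp only [hW]; field_simp
  -- the algebraic inequality at the horizon
  have hneg : P rp / 4 + W rp < 0 := by
    have hq : q0 ^ 2 = l * (q0 ^ 2 / l) := by field_simp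
    have h2q : q0 ^ 2 / (2 * l) = (q0 ^ 2 / l) / 2 := by field_simp
    have h3q : 2 * q0 ^ 2 / l = 2 * (q0 ^ 2 / l) := by ring
    rw [h2q] at hR0 hα3
    rw [h3q] at hR0
    have hPr : P rp = 6 * (l * rp ^ 2) + 1 := by simp only [hP]; ring
    have hPp := hPpos rp le_rfl
    have hWr : W rp = α * (l * rp ^ 2)
        - (q0 ^ 2 / l) * (l * rp ^ 2) * (1 + 3 * (l * rp ^ 2)) / P rp := by
      simp only [hW]; field_simp
    generalize q0 ^ 2 / l = Q at *
    generalize l * rp ^ 2 = x at *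
    rw [hWr, hPr]
    rw [hPr] at hPp
    have hx : 24 * (α + 3 / 2 - Q / 2) * x ^ 2
        + (4 * (α + 3 / 2 - Q / 2) - 2 * Q + 6) * x + 1 < 0 := by
      have hx0 : 0 < x := by linarith
      have key : R0 * (24 * (α + 3 / 2 - Q / 2) * x ^ 2
        + (4 * (α + 3 / 2 - Q / 2) - 2 * Q + 6) * x + 1)
          = (x - R0) * (24 * (α + 3 / 2 - Q / 2) * x * R0 - 1) := by
        linear_combination x * hR0
      have h7 : 24 * (α + 3 / 2 - Q / 2) * x * R0 < 0 := by
        have : 24 * (α + 3 / 2 - Q / 2) < 0 := by linarith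
        have := mul_neg_of_neg_of_pos this hx0
        exact mul_neg_of_neg_of_pos this hR0pos
      have h8 : (x - R0) * (24 * (α + 3 / 2 - Q / 2) * x * R0 - 1) < 0 :=
        mul_neg_of_pos_of_neg (by linarith) (by linarith)
      rw [← key] at h8
      by_contra h9
      have := mul_nonneg hR0pos.le (not_lt.1 h9)
      linarith
    have e : (6 * x + 1) / 4 + (α * x - Q * x * (1 + 3 * x) / (6 * x + 1)) =
      (24 * (α + 3 / 2 - Q / 2) * x ^ 2
        + (4 * (α + 3 / 2 - Q / 2) - 2 * Q + 6) * x + 1) / (4 * (6 * x + 1)) := by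
      have := hPp.ne'
      field_simp; ring
    rw [e]
    exact div_neg_of_neg_of_pos hx (by linarith)
  -- constants
  obtain ⟨η, hη, hη2⟩ : ∃ η : ℝ, 0 < η ∧ (P rp + η) / 4 < -(W rp) - η :=
    ⟨-(P rp / 4 + W rp) / 2, by linarith, by linarith⟩
  have hWc : ContinuousAt W rp := by
    have := (hPpos rp le_rfl).ne'
    simp only [hW]
    exact ContinuousAt.sub (by fun_prop)
      (ContinuousAt.div (by fun_prop) hPc.continuousAt this)
  have ev1 : ∀ᶠ r in nhds rp, P r < P rp + η :=
    hPc.continuousAt.eventually_lt continuousAt_const (by linarith)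
  have ev2 : ∀ᶠ r in nhds rp, W r < W rp + η :=
    hWc.eventually_lt continuousAt_const (by linarith)
  obtain ⟨δ, hδ, hball⟩ := Metric.eventually_nhds_iff.1 (ev1.and ev2)
  obtain ⟨g, a, hgc, hgs, hgt, hgi⟩ := aux_bump (P rp + η) (-(W rp) - η) (Real.log (δ / 2))
    (by linarith [hPpos rp le_rfl]) hη2
  obtain ⟨f, hf1, hf2, hf3, hf4⟩ := aux_f rp a _ g hgc hgt
  refine ⟨f, hf1, hf2, hf3, ?_⟩
  rw [aux_cov]
  have hint : ∀ y, Real.exp y * ((rp + Real.exp y) ^ 2 * Ω2 (rp + Real.exp y)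
        * (deriv f (rp + Real.exp y)) ^ 2
      + (l * α - q0 ^ 2 * e02 * (1 / rp - 1 / (rp + Real.exp y)) ^ 2 / Ω2 (rp + Real.exp y))
        * (rp + Real.exp y) ^ 2 * (f (rp + Real.exp y)) ^ 2)
      = P (rp + Real.exp y) * (deriv g y - g y / 2) ^ 2 + W (rp + Real.exp y) * (g y) ^ 2 := by
    intro y
    have hy : rp < rp + Real.exp y := by linarith [Real.exp_pos y]
    rw [hOm _ hy, hWe _ hy, (hf4 y).1, (hf4 y).2]
    have h1 : Real.exp y * Real.exp (-y / 2) ^ 2 = 1 := by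
      rw [← Real.exp_nat_mul, ← Real.exp_add, ← Real.exp_zero]; congr 1; push_cast; ring
    have h2 := Real.exp_ne_zero y
    have h3 : rp + Real.exp y - rp = Real.exp y := by ring
    rw [h3]
    generalize P (rp + Real.exp y) = p
    generalize W (rp + Real.exp y) = w
    generalize Real.exp (-y / 2) = u at *
    have h4 : Real.exp y * (u / Real.exp y * (deriv g y - g y / 2)) = u * (deriv g y - g y / 2) := by
      field_simp
    generalize u / Real.exp y * (deriv g y - g y / 2) = v at *
    generalize Real.exp y = s at *
    have h5 : (s * v) ^ 2 = u ^ 2 * (deriv g y - g y / 2) ^ 2 := by rw [h4]; ring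
    linear_combination s * p * h5 + (p * (deriv g y - g y / 2) ^ 2 + w * g y ^ 2) * h1
  simp_rw [hint]
  have hgd : Continuous (deriv g) := hgc.continuous_deriv (by simp)
  have hgc0 : Continuous g := hgc.continuous
  have hcs1 : HasCompactSupport (fun y => (deriv g y - g y / 2) ^ 2) := by
    have h1 : HasCompactSupport (fun y => g y / 2) :=
      hgs.comp_left (g := fun x : ℝ => x / 2) (by simp)
    exact (hgs.deriv.sub h1).comp_left (g := fun x : ℝ => x ^ 2) (by simp)
  have hcs2 : HasCompactSupport (fun y => (g y) ^ 2) :=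
    hgs.comp_left (g := fun x : ℝ => x ^ 2) (by simp)
  have hPe : Continuous (fun y => P (rp + Real.exp y)) := hPc.comp (by fun_prop)
  have hWe2 : Continuous (fun y => W (rp + Real.exp y)) := by
    simp only [hW]
    refine Continuous.sub (by fun_prop) (Continuous.div (by fun_prop) hPe ?_)
    intro y
    exact (hPpos _ (by linarith [Real.exp_pos y])).ne'
  refine lt_of_le_of_lt (integral_mono ?_ ?_ ?_) hgi
  · exact ((hPe.mul (by fun_prop)).integrable_of_hasCompactSupport hcs1.mul_left).add
      ((hWe2.mul (by fun_prop)).integrable_of_hasCompactSupport hcs2.mul_left)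
  · exact ((continuous_const.mul (by fun_prop)).integrable_of_hasCompactSupport hcs1.mul_left).sub
      ((continuous_const.mul (by fun_prop)).integrable_of_hasCompactSupport hcs2.mul_left)
  · intro y
    by_cases hy : y ∈ tsupport g
    · have h1 := (Real.le_log_iff_exp_le (by linarith)).1 (hgt hy).2
      have h2 : dist (rp + Real.exp y) rp < δ := by
        rw [Real.dist_eq, add_sub_cancel_left, abs_of_pos (Real.exp_pos y)]; linarith
      obtain ⟨h3, h4⟩ := hball h2
      have h5 := mul_le_mul_of_nonneg_right h3.le (sq_nonneg (deriv g y - g y / 2))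
      have h6 := mul_le_mul_of_nonneg_right h4.le (sq_nonneg (g y))
      simp only
      linarith
    · have h1 : g y = 0 := image_eq_zero_of_notMem_tsupport hy
      have h2 : deriv g y = 0 := by
        by_contra h0
        exact hy (support_deriv_subset h0)
      simp [h1, h2]
end

section
/- For fixed sub-extremal parameters (M_b, r₊, Λ, α) with -9/4 < α < 0 and M_{e=0} < M_b < M₀, there exists q₁ > 0 (depending on M_b, r₊, Λ, α) such that for all q₀ with |q₀| > q₁, the energy functional L_{M_b}[f] = ∫_{r₊}^∞ r²Ω²(f')² + ((-Λ/3)α - q₀²A²/Ω²) r² f² dr admits a negative energy bound state: there is f ∈ C_c^∞(r₊, ∞) with L_{M_b}[f] < 0. -/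
open MeasureTheory Set

/-- Large-charge negative energy bound state: for fixed sub-extremal parameters
`(M_b, r₊, Λ, α)` with `-9/4 < α < 0` and `M_{e=0} < M_b < M₀`, there exists
`q₁ > 0` such that for every `|q₀| > q₁` the energy functional `L_{M_b}` admits a
smooth compactly supported `f` with `L_{M_b}[f] < 0`. -/
theorem large_charge_negative_energy_bound_state (rp Λ α Mb : ℝ)
    (hrp : 0 < rp) (hΛ : Λ < 0) (hα1 : -9 / 4 < α) (hα2 : α < 0)
    (Me0 M0 : ℝ) (hMe0 : Me0 = rp / 2 * (1 + (-Λ / 3) * rp ^ 2))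
    (hM0 : M0 = rp * (1 + 2 * (-Λ / 3) * rp ^ 2))
    (hMb1 : Me0 < Mb) (hMb2 : Mb < M0)
    (e2 : ℝ) (he2 : e2 = -rp ^ 2 * (1 - 2 * Mb / rp + (-Λ / 3) * rp ^ 2))
    (Ω2 : ℝ → ℝ)
    (hΩ2 : ∀ r : ℝ, Ω2 r = 1 - 2 * Mb / r + e2 / r ^ 2 + (-Λ / 3) * r ^ 2) :
    ∃ q1 > 0, ∀ q0 : ℝ, q1 < |q0| →
      ∃ f : ℝ → ℝ, ContDiff ℝ (⊤ : ℕ∞) f ∧ HasCompactSupport f ∧ tsupport f ⊆ Set.Ioi rp ∧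
        (∫ r in Set.Ioi rp,
          (r ^ 2 * Ω2 r * (deriv f r) ^ 2
            + ((-Λ / 3) * α - q0 ^ 2 * e2 * (1 / rp - 1 / r) ^ 2 / Ω2 r)
                * r ^ 2 * (f r) ^ 2)) < 0 := by
  set l : ℝ := -Λ / 3 with hl
  have hlpos : 0 < l := by rw [hl]; linarith
  have he2' : e2 = 2 * Mb * rp - rp ^ 2 - l * rp ^ 4 := by
    rw [he2]; field_simp; ring
  have he2pos : 0 < e2 := by
    rw [he2']
    have h1 : 0 < rp * (Mb - rp / 2 * (1 + l * rp ^ 2)) := mul_pos hrp (by linarith)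
    nlinarith
  have hpos : ∀ r, rp < r → 0 < Ω2 r := by
    intro r hr
    have hr0 : 0 < r := hrp.trans hr
    have e1 : Ω2 r = ((r - rp) * (l * (r ^ 3 + r ^ 2 * rp + r * rp ^ 2 + rp ^ 3) + r + rp - 2 * Mb))
        / r ^ 2 := by
      rw [hΩ2, he2']; field_simp; ring
    rw [e1]
    refine div_pos (mul_pos (by linarith) ?_) (by positivity)
    have h3 : rp ^ 3 ≤ r ^ 3 := by gcongr
    have h2 : rp ^ 2 * rp ≤ r ^ 2 * rp := by gcongr
    have h1 : rp * rp ^ 2 ≤ r * rp ^ 2 := by gcongr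
    have h4 : l * (4 * rp ^ 3) ≤ l * (r ^ 3 + r ^ 2 * rp + r * rp ^ 2 + rp ^ 3) := by
      apply mul_le_mul_of_nonneg_left _ hlpos.le
      nlinarith
    nlinarith
  let b : ContDiffBump (rp + 2) := ⟨1 / 2, 1, by norm_num, by norm_num⟩
  let f : ℝ → ℝ := b
  have hfs : ContDiff ℝ (⊤ : ℕ∞) f := b.contDiff
  have hfc : HasCompactSupport f := b.hasCompactSupport
  have hts : tsupport f = Icc (rp + 1) (rp + 3) := by
    have := b.tsupport_eq
    change tsupport f = Metric.closedBall (rp + 2) 1 at this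
    rw [this, Real.closedBall_eq_Icc]
    congr 1 <;> ring
  have hf0 : ∀ r, r ∉ Icc (rp + 1) (rp + 3) → f r = 0 := fun r hr =>
    image_eq_zero_of_notMem_tsupport (by rwa [hts])
  have hd0 : ∀ r, r ∉ Icc (rp + 1) (rp + 3) → deriv f r = 0 := fun r hr => by
    by_contra h
    exact hr (hts ▸ support_deriv_subset h)
  have hsub : Icc (rp + 1) (rp + 3) ⊆ Ioi rp := fun r hr => by
    have := hr.1
    simp only [mem_Ioi]; linarith
  have hfcont : Continuous f := hfs.continuous
  have hdcont : Continuous (deriv f) := hfs.continuous_deriv (by simp)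
  have hΩc : ContinuousOn Ω2 (Ioi rp) := by
    have : Ω2 = fun r => 1 - 2 * Mb / r + e2 / r ^ 2 + l * r ^ 2 := funext hΩ2
    rw [this]
    have h0 : ∀ r ∈ Ioi rp, r ≠ 0 := fun r hr => (hrp.trans hr).ne'
    have h02 : ∀ r ∈ Ioi rp, r ^ 2 ≠ 0 := fun r hr => pow_ne_zero 2 (h0 r hr)
    fun_prop (disch := assumption)
  have hint : ∀ g : ℝ → ℝ, ContinuousOn g (Ioi rp) →
      (∀ r, r ∉ Icc (rp + 1) (rp + 3) → g r = 0) → IntegrableOn g (Ioi rp) := by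
    intro g hg h0
    exact ((hg.mono hsub).integrableOn_Icc).of_forall_diff_eq_zero measurableSet_Ioi
      (fun x hx => h0 x hx.2)
  let F : ℝ → ℝ := fun r => r ^ 2 * Ω2 r * (deriv f r) ^ 2 + l * α * r ^ 2 * (f r) ^ 2
  let G : ℝ → ℝ := fun r => e2 * (1 / rp - 1 / r) ^ 2 / Ω2 r * r ^ 2 * (f r) ^ 2
  have hF : IntegrableOn F (Ioi rp) := by
    apply hint
    · fun_prop
    · intro r hr
      simp [F, hf0 r hr, hd0 r hr]
  have hG : IntegrableOn G (Ioi rp) := by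
    apply hint
    · have h0 : ∀ r ∈ Ioi rp, r ≠ 0 := fun r hr => (hrp.trans hr).ne'
      have h1 : ∀ r ∈ Ioi rp, Ω2 r ≠ 0 := fun r hr => (hpos r hr).ne'
      fun_prop (disch := assumption)
    · intro r hr
      simp [G, hf0 r hr]
  have hGpos : 0 < ∫ r in Ioi rp, G r := by
    rw [setIntegral_pos_iff_support_of_nonneg_ae _ hG]
    · have hss : Ioo (rp + 3 / 2) (rp + 5 / 2) ⊆ Function.support G ∩ Ioi rp := by
        intro r hr
        have hr1 : rp < r := by linarith [hr.1]
        have hr0 : 0 < r := hrp.trans hr1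
        refine ⟨?_, hr1⟩
        have hf1 : f r = 1 := by
          apply b.one_of_mem_closedBall
          change r ∈ Metric.closedBall (rp + 2) (1 / 2)
          rw [Real.closedBall_eq_Icc]
          constructor <;> linarith [hr.1, hr.2]
        have h1 : 0 < 1 / rp - 1 / r := sub_pos.2 (one_div_lt_one_div_of_lt hrp hr1)
        have h2 := hpos r hr1
        have : 0 < G r := by
          simp only [G, hf1]
          positivity
        exact this.ne'
      refine lt_of_lt_of_le ?_ (measure_mono hss)
      rw [Real.volume_Ioo]
      simp only [ENNReal.ofReal_pos]
      linarith
    · refine (ae_restrict_iff' measurableSet_Ioi).2 (Filter.Eventually.of_forall fun r hr => ?_)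
      have h2 := hpos r hr
      simp only [G, Pi.zero_apply]
      positivity
  set a1 := ∫ r in Ioi rp, F r with ha1
  set a2 := ∫ r in Ioi rp, G r with ha2
  have hq : 0 ≤ |a1| / a2 := by positivity
  refine ⟨|a1| / a2 + 1, by positivity, fun q0 hq0 => ⟨f, hfs, hfc, hts ▸ hsub, ?_⟩⟩
  have heq : (fun r => r ^ 2 * Ω2 r * (deriv f r) ^ 2
            + (l * α - q0 ^ 2 * e2 * (1 / rp - 1 / r) ^ 2 / Ω2 r)
                * r ^ 2 * (f r) ^ 2) = fun r => F r - q0 ^ 2 * G r := by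
    funext r
    simp only [F, G]
    ring
  rw [heq, integral_sub hF (hG.const_mul _), integral_const_mul, ← ha1, ← ha2]
  have h1 : |a1| / a2 < q0 ^ 2 := by
    rw [← sq_abs]
    nlinarith
  rw [div_lt_iff₀ hGpos] at h1
  linarith [le_abs_self a1]
end
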